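/- Let m ≥ 2, n ≥ 2m+1, and let π = (d_1, …, d_n) be a non-increasing graphic sequence with σ(π) ≥ max{2n + 4m² − 6m, m(2n − m − 1)} + 2. Then π is potentially C_{2m+1}-graphic; moreover, if m ≥ 2 then π satisfies d_{2m+2−i} ≥ i+1 for every 1 ≤ i ≤ m, so π even has a realization containing cycles of every length r with 3 ≤ r ≤ 2m+1. -/

import Mathlib

/-- `G` contains a cycle of length `r`. -/
def hasCycleOfLength {V : Type*} (G : SimpleGraph V) (r : ℕ) : Prop :=
  ∃ (v : V) (c : G.Walk v v), c.IsCycle ∧ c.length = r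

/-- `G` is a realization of the sequence `d`, i.e. `d` is its degree sequence. -/
def IsDegreeSeq {n : ℕ} (G : SimpleGraph (Fin n)) (d : Fin n → ℕ) : Prop :=
  ∀ i, (G.neighborSet i).ncard = d i

/-- The sequence `d` is graphic: it is the degree sequence of a simple graph. -/
def Graphic {n : ℕ} (d : Fin n → ℕ) : Prop :=
  ∃ G : SimpleGraph (Fin n), IsDegreeSeq G d

/-- `d` is potentially ₃Cℓ-graphic: some realization contains cycles of every
length `r` with `3 ≤ r ≤ ℓ`. -/
def Pot3C {n : ℕ} (ℓ : ℕ) (d : Fin n → ℕ) : Prop :=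
  ∃ G : SimpleGraph (Fin n), IsDegreeSeq G d ∧ ∀ r, 3 ≤ r → r ≤ ℓ → hasCycleOfLength G r

/-- `d` is potentially Cℓ-graphic: some realization contains a cycle of length `ℓ`. -/
def PotC {n : ℕ} (ℓ : ℕ) (d : Fin n → ℕ) : Prop :=
  ∃ G : SimpleGraph (Fin n), IsDegreeSeq G d ∧ hasCycleOfLength G ℓ

/-- `d` has a realization `G` containing cycles `C₃, …, C_ℓ` on those vertices with
degrees `d 0, …, d (ℓ-1)`: the induced subgraph on some vertex set `S`, whose multiset
of degrees is that of the first `ℓ` terms of `d`, contains cycles of all lengths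
from `3` to `ℓ`. -/
def RealizationWithCyclesOn {n : ℕ} (ℓ : ℕ) (d : Fin n → ℕ) : Prop :=
  ∃ (G : SimpleGraph (Fin n)) (S : Finset (Fin n)),
    IsDegreeSeq G d ∧ S.card = ℓ ∧
    S.val.map d = (Finset.univ.filter (fun i : Fin n => (i : ℕ) < ℓ)).val.map d ∧
    ∀ r, 3 ≤ r → r ≤ ℓ → hasCycleOfLength (G.induce (S : Set (Fin n))) r

section Infra
open Classical Finset

variable {U : Type*}

/-- Degree of `v` inside the vertex set `A`. -/
noncomputable def dg (G : SimpleGraph U) (A : Finset U) (v : U) : ℕ := (A.filter (G.Adj v)).card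

/-- Add the edge `uv`. -/
def addE (G : SimpleGraph U) (u v : U) : SimpleGraph U where
  Adj x y := G.Adj x y ∨ (x ≠ y ∧ ((x = u ∧ y = v) ∨ (x = v ∧ y = u)))
  symm := ⟨by
    rintro x y (h | ⟨h, h' | h'⟩)
    · exact Or.inl h.symm
    · exact Or.inr ⟨h.symm, Or.inr ⟨h'.2, h'.1⟩⟩
    · exact Or.inr ⟨h.symm, Or.inl ⟨h'.2, h'.1⟩⟩⟩
  loopless := ⟨by
    rintro x (h | ⟨h, _⟩)
    · exact G.loopless.irrefl x h
    · exact h rfl⟩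

/-- Delete the edge `uv`. -/
def delE (G : SimpleGraph U) (u v : U) : SimpleGraph U where
  Adj x y := G.Adj x y ∧ ¬ ((x = u ∧ y = v) ∨ (x = v ∧ y = u))
  symm := ⟨by
    rintro x y ⟨h, h'⟩
    exact ⟨h.symm, fun h2 => h' (by tauto)⟩⟩
  loopless := ⟨by
    rintro x ⟨h, _⟩
    exact G.loopless.irrefl x h⟩

/-- Make `T` the neighbourhood of `x`, leaving the rest. -/
def addV (G : SimpleGraph U) (x : U) (T : Finset U) : SimpleGraph U where
  Adj a b := (G.Adj a b ∧ a ≠ x ∧ b ≠ x) ∨ (a = x ∧ b ∈ T ∧ b ≠ x) ∨ (b = x ∧ a ∈ T ∧ a ≠ x)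
  symm := ⟨by
    rintro a b (⟨h, h1, h2⟩ | h | h)
    · exact Or.inl ⟨h.symm, h2, h1⟩
    · exact Or.inr (Or.inr h)
    · exact Or.inr (Or.inl h)⟩
  loopless := ⟨by
    rintro a (⟨h, h1, h2⟩ | h | h)
    · exact G.loopless.irrefl a h
    · exact h.2.2 h.1
    · exact h.2.2 h.1⟩

theorem dg_addE (G : SimpleGraph U) (A : Finset U) {u v : U} (huv : u ≠ v) (hn : ¬ G.Adj u v)
    (w : U) : dg (addE G u v) A w =
      dg G A w + (if w = u ∧ v ∈ A then 1 else 0) + (if w = v ∧ u ∈ A then 1 else 0) := by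
  unfold dg
  have hn' : ¬ G.Adj v u := fun h => hn h.symm
  by_cases hwu : w = u
  · subst hwu
    have : w ≠ v := huv
    by_cases hv : v ∈ A
    · have : A.filter ((addE G w v).Adj w) = insert v (A.filter (G.Adj w)) := by
        ext y; simp only [addE, mem_filter, mem_insert]
        constructor
        · rintro ⟨h1, h2 | h2⟩
          · exact Or.inr ⟨h1, h2⟩
          · left; rcases h2.2 with h | h
            · exact h.2
            · exact absurd h.1 huv
        · rintro (h | h)
          · subst h; exact ⟨hv, Or.inr ⟨huv, by simp⟩⟩
          · exact ⟨h.1, Or.inl h.2⟩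
      rw [this, card_insert_of_notMem (by simp [hn])]
      simp [hv, huv]
    · have : A.filter ((addE G w v).Adj w) = (A.filter (G.Adj w)) := by
        apply filter_congr
        intro y hy; simp only [addE]
        constructor
        · rintro (h2 | h2)
          · exact h2
          · rcases h2.2 with h | h
            · exact absurd (h.2 ▸ hy) hv
            · exact absurd h.1 huv
        · exact Or.inl
      rw [this]
      simp [hv, huv]
  · by_cases hwv : w = v
    · subst hwv
      by_cases hv : u ∈ A
      · have : A.filter ((addE G u w).Adj w) = insert u (A.filter (G.Adj w)) := by
          ext y; simp only [addE, mem_filter, mem_insert]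
          constructor
          · rintro ⟨h1, h2 | h2⟩
            · exact Or.inr ⟨h1, h2⟩
            · left; rcases h2.2 with h | h
              · exact absurd h.1 huv.symm
              · exact h.2
          · rintro (h | h)
            · subst h; exact ⟨hv, Or.inr ⟨huv.symm, by simp⟩⟩
            · exact ⟨h.1, Or.inl h.2⟩
        rw [this, card_insert_of_notMem (by simp [hn'])]
        simp [hv, hwu]
      · have : A.filter ((addE G u w).Adj w) = (A.filter (G.Adj w)) := by
          apply filter_congr
          intro y hy; simp only [addE]
          constructor
          · rintro (h2 | h2)
            · exact h2
            · rcases h2.2 with h | h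
              · exact absurd h.1 huv.symm
              · exact absurd (h.2 ▸ hy) hv
          · exact Or.inl
        rw [this]
        simp [hv, hwu]
    · have : A.filter ((addE G u v).Adj w) = (A.filter (G.Adj w)) := by
        apply filter_congr
        intro y hy; simp only [addE]
        tauto
      rw [this]; simp [hwu, hwv]

theorem addE_delE (G : SimpleGraph U) {u v : U} (h : G.Adj u v) : addE (delE G u v) u v = G := by
  ext x y
  simp only [addE, delE]
  constructor
  · rintro (h1 | ⟨h1, h2 | h2⟩)
    · exact h1.1
    · rw [h2.1, h2.2]; exact h
    · rw [h2.1, h2.2]; exact h.symm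
  · intro h1
    have := h1.ne
    tauto

theorem dg_delE (G : SimpleGraph U) (A : Finset U) {u v : U} (h : G.Adj u v)
    (w : U) : dg G A w = dg (delE G u v) A w +
      (if w = u ∧ v ∈ A then 1 else 0) + (if w = v ∧ u ∈ A then 1 else 0) := by
  have := dg_addE (delE G u v) A h.ne (by simp [delE]) w
  rwa [addE_delE G h] at this

theorem dg_split (G : SimpleGraph U) {A P : Finset U} (hP : P ⊆ A) (v : U) :
    dg G A v = dg G P v + dg G (A \ P) v := by
  unfold dg
  rw [← card_union_of_disjoint, ← filter_union, union_sdiff_of_subset hP]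
  exact disjoint_filter_filter disjoint_sdiff

theorem dg_erase (G : SimpleGraph U) {A : Finset U} {x : U} (hx : x ∈ A) (v : U) :
    dg G A v = dg G (A.erase x) v + if G.Adj v x then 1 else 0 := by
  rw [dg_split G (erase_subset x A)]
  congr 1
  have : A \ A.erase x = {x} := by ext y; simp; constructor
                                   · rintro ⟨h1, h2⟩; by_contra h; exact h2 h h1
                                   · rintro rfl; exact ⟨hx, by simp⟩
  rw [this]; unfold dg; rw [filter_singleton]; split_ifs <;> simp

theorem dg_self_erase (G : SimpleGraph U) {A : Finset U} {x : U} (hx : x ∈ A)  :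
    dg G (A.erase x) x = dg G A x := by
  rw [dg_erase G hx x]; simp

theorem dg_mono (G : SimpleGraph U) {A B : Finset U} (h : A ⊆ B) (v : U) : dg G A v ≤ dg G B v :=
  card_le_card (filter_subset_filter _ h)

theorem dg_lt (G : SimpleGraph U) {A : Finset U} {v : U} (h : v ∈ A) : dg G A v + 1 ≤ A.card := by
  rw [← dg_self_erase G h]
  have : dg G (A.erase v) v ≤ (A.erase v).card := card_filter_le _ _
  rw [card_erase_of_mem h] at this
  have := card_pos.mpr ⟨v, h⟩
  omega

theorem dg_le_card (G : SimpleGraph U) (A : Finset U) (v : U) : dg G A v ≤ A.card :=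
  card_filter_le _ _

theorem dg_comm (G : SimpleGraph U) (P Q : Finset U) :
    ∑ v ∈ P, dg G Q v = ∑ v ∈ Q, dg G P v := by
  unfold dg
  simp only [card_filter]
  rw [sum_comm]
  simp only [G.adj_comm]

theorem dg_congr {G H : SimpleGraph U} {A : Finset U} {v : U} (h : ∀ w ∈ A, (G.Adj v w ↔ H.Adj v w)) :
    dg G A v = dg H A v := by
  unfold dg; rw [filter_congr h]

theorem sum_dg_even [Fintype U] (G : SimpleGraph U) (A : Finset U) : Even (∑ v ∈ A, dg G A v) := by
  let H : SimpleGraph U :=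
    { Adj := fun u v => G.Adj u v ∧ u ∈ A ∧ v ∈ A
      symm := ⟨fun u v h => ⟨h.1.symm, h.2.2, h.2.1⟩⟩
      loopless := ⟨fun u h => G.loopless.irrefl u h.1⟩ }
  have h1 := H.sum_degrees_eq_twice_card_edges
  have h2 : ∑ v, H.degree v = ∑ v ∈ A, dg G A v := by
    rw [← sum_subset (subset_univ A)]
    · apply sum_congr rfl
      intro v hv
      rw [← SimpleGraph.card_neighborFinset_eq_degree]
      unfold dg
      congr 1
      ext w; simp [H, hv, and_comm]
    · intro v _ hv
      rw [← SimpleGraph.card_neighborFinset_eq_degree, card_eq_zero]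
      ext w; simp [H, hv]
  rw [← h2, h1]; exact even_two_mul _

theorem count_bound (G : SimpleGraph U) {A K : Finset U} (hK : K ⊆ A) (i : ℕ)
    (h : ∀ v ∈ A \ K, dg G A v ≤ i) :
    ∑ v ∈ A, dg G A v ≤ K.card * (K.card - 1) + 2 * i * (A.card - K.card) := by
  rw [← sum_sdiff hK]
  have e1 : ∑ v ∈ K, dg G A v = ∑ v ∈ K, dg G K v + ∑ v ∈ A \ K, dg G K v := by
    rw [dg_comm G (A \ K) K, ← sum_add_distrib]; exact sum_congr rfl fun v _ => dg_split G hK v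
  have e2 : ∑ v ∈ A \ K, dg G K v ≤ ∑ v ∈ A \ K, dg G A v := sum_le_sum fun v _ => dg_mono G hK v
  have e3 : ∑ v ∈ A \ K, dg G A v ≤ (A \ K).card * i := by
    rw [← smul_eq_mul]; exact sum_le_card_nsmul _ _ _ h
  have e4 : ∑ v ∈ K, dg G K v ≤ K.card * (K.card - 1) := by
    rw [← smul_eq_mul]; apply sum_le_card_nsmul; intro v hv
    have := dg_lt G hv; omega
  rw [card_sdiff_of_subset hK] at e3
  nlinarith

/-- Realization of `d` on the vertex set `A`. -/
def Rz (G : SimpleGraph U) (A : Finset U) (d : U → ℕ) : Prop := ∀ v ∈ A, dg G A v = d v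

theorem exists_top (S : Finset U) (f : U → ℕ) (k : ℕ) (hk : k ≤ S.card) :
    ∃ T ⊆ S, T.card = k ∧ ∀ t ∈ T, ∀ u ∈ S \ T, f u ≤ f t := by
  induction k with
  | zero => exact ⟨∅, empty_subset _, rfl, by simp⟩
  | succ k ih =>
    obtain ⟨T, hT, hc, ht⟩ := ih (by omega)
    have hne : (S \ T).Nonempty := by
      rw [← card_pos, card_sdiff_of_subset hT]; omega
    obtain ⟨a, ha, hmax⟩ := exists_max_image (S \ T) f hne
    rw [mem_sdiff] at ha
    refine ⟨insert a T, insert_subset ha.1 hT, by rw [card_insert_of_notMem ha.2, hc], ?_⟩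
    intro t htT u hu
    have hu' : u ∈ S \ T := by
      rw [mem_sdiff] at hu ⊢; exact ⟨hu.1, fun h => hu.2 (mem_insert_of_mem h)⟩
    rcases mem_insert.1 htT with rfl | h
    · exact hmax u hu'
    · exact ht t h u hu'

theorem rz_addV {G : SimpleGraph U} {A T : Finset U} {x : U} {d d' : U → ℕ} (hx : x ∈ A)
    (hT : T ⊆ A.erase x) (hG : Rz G (A.erase x) d')
    (hd : ∀ v ∈ A.erase x, d v = d' v + if v ∈ T then 1 else 0) (hdx : d x = T.card) :
    Rz (addV G x T) A d := by
  have hxT : x ∉ T := fun h => by simpa using hT h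
  intro v hv
  by_cases hvx : v = x
  · subst hvx
    rw [hdx]; unfold dg; congr 1
    ext y; simp only [addV, mem_filter]
    constructor
    · rintro ⟨_, h | h | h⟩
      · exact absurd rfl h.2.1
      · exact h.2.1
      · exact absurd rfl h.2.2
    · intro h
      have := mem_erase.1 (hT h)
      exact ⟨this.2, by simp [h, this.1]⟩
  · have hv' : v ∈ A.erase x := mem_erase.2 ⟨hvx, hv⟩
    rw [hd v hv', dg_erase _ hx, ← hG v hv']
    congr 1
    · apply dg_congr
      intro w hw
      simp only [addV]
      have := (mem_erase.1 hw).1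
      tauto
    · simp only [addV]
      by_cases h : v ∈ T <;> simp [h, hvx]

/-- Havel–Hakimi exchange. -/
theorem hh {A T : Finset U} {x : U} {d : U → ℕ} (hx : x ∈ A) (hT : T ⊆ A.erase x)
    (hc : T.card = d x) (htop : ∀ t ∈ T, ∀ u ∈ A.erase x \ T, d u ≤ d t)
    (hr : ∃ G : SimpleGraph U, Rz G A d) :
    ∃ G : SimpleGraph U, Rz G A d ∧ ∀ v ∈ A, (G.Adj x v ↔ v ∈ T) := by
  have hxT : x ∉ T := fun h => by simpa using hT h
  suffices H : ∀ k, ∀ G : SimpleGraph U, Rz G A d → (T.filter fun t => ¬ G.Adj x t).card = k →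
      ∃ G : SimpleGraph U, Rz G A d ∧ ∀ v ∈ A, (G.Adj x v ↔ v ∈ T) by
    obtain ⟨G, hG⟩ := hr
    exact H _ G hG rfl
  intro k
  induction k using Nat.strong_induction_on with
  | _ k ih =>
  intro G hG hk
  have hTA : T ⊆ A := hT.trans (erase_subset _ _)
  by_cases h0 : k = 0
  · subst h0
    rw [card_eq_zero, filter_eq_empty_iff] at hk
    push Not at hk
    refine ⟨G, hG, ?_⟩
    have hsub : T ⊆ A.filter (G.Adj x) := fun t ht => mem_filter.2 ⟨hTA ht, hk ht⟩
    have heq := eq_of_subset_of_card_le hsub (by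
      rw [hc, ← hG x hx]; exact le_rfl)
    intro v hv
    constructor
    · intro h; rw [heq]; exact mem_filter.2 ⟨hv, h⟩
    · intro h; exact hk h
  · have : (T.filter fun t => ¬ G.Adj x t).Nonempty := by rw [← card_pos]; omega
    obtain ⟨a, ha⟩ := this
    rw [mem_filter] at ha
    -- b ∈ N(x) \ T
    have : ∃ b ∈ A.filter (G.Adj x), b ∉ T := by
      by_contra hcon
      push Not at hcon
      have hsub : A.filter (G.Adj x) ⊆ T := hcon
      have heq := eq_of_subset_of_card_le hsub (by
        rw [hc, ← hG x hx]; exact le_rfl)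
      rw [← heq] at ha
      exact ha.2 (mem_filter.1 ha.1).2
    obtain ⟨b, hb, hbT⟩ := this
    rw [mem_filter] at hb
    have hbx : b ≠ x := hb.2.ne'
    have hax : a ≠ x := fun h => hxT (h ▸ ha.1)
    have hab : a ≠ b := fun h => hbT (h ▸ ha.1)
    have hdab : d b ≤ d a := htop a ha.1 b (by simp [hbx, hb.1, hbT])
    have haA := hTA ha.1
    -- u
    have : ∃ u ∈ A, G.Adj a u ∧ ¬ G.Adj b u ∧ u ≠ b ∧ u ≠ x := by
      by_contra hcon
      push Not at hcon
      have hsub : (A.filter (G.Adj a)).erase b ⊆ ((A.filter (G.Adj b)).erase a).erase x := by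
        intro u hu
        simp only [mem_erase, mem_filter] at hu ⊢
        have hux : u ≠ x := by rintro rfl; exact ha.2 hu.2.2.symm
        refine ⟨hux, hu.2.2.ne', hu.2.1, ?_⟩
        by_contra hbu
        exact hux (hcon u hu.2.1 hu.2.2 hbu hu.1)
      have h1 := card_le_card hsub
      have h2 : x ∈ (A.filter (G.Adj b)).erase a := by simp [hax.symm, hx, hb.2.symm]
      rw [card_erase_of_mem h2] at h1
      have h3 := card_pos.2 ⟨x, h2⟩
      have h4 : dg G A a = d a := hG a haA
      have h5 : dg G A b = d b := hG b hb.1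
      unfold dg at h4 h5
      rw [card_erase_eq_ite, card_erase_eq_ite] at h1
      rw [card_erase_eq_ite] at h3
      by_cases hadj : G.Adj a b
      · have hm1 : b ∈ A.filter (G.Adj a) := by simp [hb.1, hadj]
        have hm2 : a ∈ A.filter (G.Adj b) := by simp [haA, hadj.symm]
        have := card_pos.2 ⟨_, hm1⟩
        rw [if_pos hm1, if_pos hm2] at h1
        rw [if_pos hm2] at h3
        omega
      · have hm1 : b ∉ A.filter (G.Adj a) := by simp [hadj]
        have hm2 : a ∉ A.filter (G.Adj b) := fun h => hadj (mem_filter.1 h).2.symm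
        rw [if_neg hm1, if_neg hm2] at h1
        rw [if_neg hm2] at h3
        omega
    obtain ⟨u, huA, hau, hbu, hub, hux⟩ := this
    have hxa : ¬ G.Adj x a := ha.2
    set G1 := delE G x b with hG1
    set G2 := delE G1 a u with hG2
    set G3 := addE G2 x a with hG3
    set G4 := addE G3 b u with hG4
    have a1 : G1.Adj a u := ⟨hau, by tauto⟩
    have a2 : ¬ G2.Adj x a := fun h => hxa h.1.1
    have a3 : ¬ G3.Adj b u := by
      rintro (h | ⟨_, h | h⟩)
      · exact hbu h.1.1
      · exact hbx h.1
      · exact hux h.2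
    have hxb := hb.2
    have hau' := hau.ne
    apply ih (T.filter fun t => ¬ G4.Adj x t).card _ G4 _ rfl
    · rw [← hk]
      apply card_lt_card
      refine ⟨?_, ?_⟩
      · intro t ht
        rw [mem_filter] at ht ⊢
        refine ⟨ht.1, fun h => ht.2 ?_⟩
        left; left
        refine ⟨⟨h, ?_⟩, ?_⟩
        · rintro (h' | h')
          · exact hbT (h'.2 ▸ ht.1)
          · exact hbx h'.1.symm
        · rintro (h' | h')
          · exact hax h'.1.symm
          · exact hux h'.1.symm
      · intro hsub
        have := hsub (mem_filter.2 ha)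
        rw [mem_filter] at this
        exact this.2 (Or.inl (Or.inr ⟨hax.symm, Or.inl ⟨rfl, rfl⟩⟩))
    · intro w hw
      have e1 := dg_delE G A hb.2 w
      have e2 := dg_delE G1 A a1 w
      have e3 := dg_addE G2 A hax.symm a2 w
      have e4 := dg_addE G3 A hub.symm a3 w
      rw [← hG w hw]
      rw [← hG4] at e4; rw [← hG3] at e3; rw [← hG2] at e2; rw [← hG1] at e1
      simp only [hx, haA, hb.1, huA, and_true] at e1 e2 e3 e4
      omega

end Infra

section Posa
open Classical Finset

variable {U : Type*}

/-- `c` is a cycle of length `2m+1` in `G` with vertices in `A`. -/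
def SCyc (m : ℕ) (G : SimpleGraph U) (A : Finset U) (c : ZMod (2 * m + 1) → U) : Prop :=
  Function.Injective c ∧ (∀ i, c i ∈ A) ∧ ∀ i, G.Adj (c i) (c (i + 1))

theorem zmod_two_ne {m : ℕ} (hm : 1 ≤ m) : (1 : ZMod (2 * m + 1)) + 1 ≠ 0 := by
  have : ((2 : ℕ) : ZMod (2 * m + 1)) ≠ 0 := by
    rw [Ne, ZMod.natCast_eq_zero_iff]
    intro h; have := Nat.le_of_dvd (by norm_num) h; omega
  intro h; apply this; push_cast; rw [← h]; norm_num

theorem zmod_cast_inj {m : ℕ} {s t : ℕ} (hs : s < 2 * m + 1) (ht : t < 2 * m + 1)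
    (h : (s : ZMod (2 * m + 1)) = t) : s = t := by
  rw [ZMod.natCast_eq_natCast_iff'] at h
  rwa [Nat.mod_eq_of_lt hs, Nat.mod_eq_of_lt ht] at h

theorem zmod_cast_2m {m : ℕ} : ((2 * m : ℕ) : ZMod (2 * m + 1)) = -1 := by
  have : ((2 * m + 1 : ℕ) : ZMod (2 * m + 1)) = 0 := ZMod.natCast_self _
  push_cast at this ⊢
  linear_combination this

theorem scyc_of_nat {m : ℕ} {G : SimpleGraph U} {A : Finset U} {q : ℕ → U}
    (hA : ∀ s, s < 2 * m + 1 → q s ∈ A)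
    (hinj : ∀ s t, s < 2 * m + 1 → t < 2 * m + 1 → q s = q t → s = t)
    (hadj : ∀ s, s < 2 * m → G.Adj (q s) (q (s + 1))) (hlast : G.Adj (q (2 * m)) (q 0)) :
    SCyc m G A (fun i => q i.val) := by
  refine ⟨?_, ?_, ?_⟩
  · intro i j h
    exact ZMod.val_injective _ (hinj _ _ (ZMod.val_lt i) (ZMod.val_lt j) h)
  · intro i; exact hA _ (ZMod.val_lt i)
  · intro i
    have hi := ZMod.val_lt i
    by_cases h : i.val = 2 * m
    · have : i + 1 = 0 := by
        rw [← ZMod.natCast_zmod_val i, h, zmod_cast_2m]; ring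
      simp only [this, h, ZMod.val_zero]; exact hlast
    · have : (i + 1).val = i.val + 1 := by
        conv_lhs => rw [← ZMod.natCast_zmod_val i]
        have := ZMod.val_cast_of_lt (n := 2 * m + 1) (a := i.val + 1) (by omega)
        push_cast at this
        exact this
      simp only [this]
      exact hadj _ (by omega)

theorem posa_core {m : ℕ} (hm : 1 ≤ m) {A : Finset U} (hA : A.card = 2 * m + 1) {G : SimpleGraph U}
    (h : ∀ i, 1 ≤ i → i ≤ m → (A.filter fun v => dg G A v ≤ i).card < i)
    (p : ℕ → U) (hpA : ∀ s, s < 2 * m + 1 → p s ∈ A)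
    (hinj : ∀ s t, s < 2 * m + 1 → t < 2 * m + 1 → p s = p t → s = t)
    (hadj : ∀ s, s < 2 * m → G.Adj (p s) (p (s + 1)))
    (hle : dg G A (p 0) ≤ dg G A (p (2 * m)))
    (hmax : ∀ w ∈ A, w ≠ p (2 * m) → ¬ G.Adj w (p (2 * m)) → dg G A w ≤ dg G A (p 0))
    (huv : ¬ G.Adj (p 0) (p (2 * m))) :
    ∃ c, SCyc m G A c := by
  by_cases hcr : ∃ t, t < 2 * m ∧ G.Adj (p 0) (p (t + 1)) ∧ G.Adj (p t) (p (2 * m))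
  · obtain ⟨t, ht, h1, h2⟩ := hcr
    refine ⟨_, scyc_of_nat (q := fun s => if s ≤ t then p s else p (2 * m + 1 + t - s)) ?_ ?_ ?_ ?_⟩
    · intro s hs; split_ifs
      · exact hpA s hs
      · exact hpA _ (by omega)
    · intro s s' hs hs' heq
      split_ifs at heq
      · exact hinj _ _ hs hs' heq
      · have := hinj _ _ (by omega) (by omega) heq; omega
      · have := hinj _ _ (by omega) (by omega) heq; omega
      · have := hinj _ _ (by omega) (by omega) heq; omega
    · intro s hs
      rcases lt_trichotomy s t with h' | h' | h'
      · rw [if_pos (by omega), if_pos (by omega)]; exact hadj s hs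
      · subst h'
        rw [if_pos (by omega), if_neg (by omega)]
        have : 2 * m + 1 + s - (s + 1) = 2 * m := by omega
        rw [this]; exact h2
      · rw [if_neg (by omega), if_neg (by omega)]
        have : 2 * m + 1 + t - s = (2 * m + 1 + t - (s + 1)) + 1 := by omega
        rw [this]; exact (hadj _ (by omega)).symm
    · rw [if_neg (by omega), if_pos (by omega)]
      have : 2 * m + 1 + t - 2 * m = t + 1 := by omega
      rw [this]; exact h1.symm
  · exfalso
    push Not at hcr
    have himg : A = (range (2 * m + 1)).image p := by
      symm
      apply eq_of_subset_of_card_le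
      · intro x hx; rw [mem_image] at hx; obtain ⟨s, hs, rfl⟩ := hx
        exact hpA s (mem_range.1 hs)
      · rw [card_image_of_injOn, hA, card_range]
        intro s hs t ht h
        simp only [coe_range, Set.mem_Iio] at hs ht
        exact hinj s t hs ht h
    set X := (range (2 * m)).filter fun t => G.Adj (p 0) (p (t + 1)) with hX
    set Y := (range (2 * m)).filter fun t => G.Adj (p t) (p (2 * m)) with hY
    have hXc : dg G A (p 0) = X.card := by
      have : A.filter (G.Adj (p 0)) = X.image fun t => p (t + 1) := by
        ext y
        rw [mem_filter, mem_image]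
        constructor
        · rintro ⟨hy, hy2⟩
          rw [himg, mem_image] at hy
          obtain ⟨s, hs, rfl⟩ := hy
          rw [mem_range] at hs
          have : s ≠ 0 := by rintro rfl; exact hy2.ne rfl
          refine ⟨s - 1, ?_, by rw [Nat.sub_add_cancel (by omega)]⟩
          rw [hX, mem_filter, mem_range, Nat.sub_add_cancel (by omega)]
          exact ⟨by omega, hy2⟩
        · rintro ⟨t, ht, rfl⟩
          rw [hX, mem_filter, mem_range] at ht
          exact ⟨hpA _ (by omega), ht.2⟩
      unfold dg; rw [this, card_image_of_injOn]
      intro s hs t ht h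
      simp only [hX, coe_filter, mem_range, Set.mem_ofPred_eq] at hs ht
      have := hinj _ _ (by omega) (by omega) h
      omega
    have hYc : dg G A (p (2 * m)) = Y.card := by
      have : A.filter (G.Adj (p (2 * m))) = Y.image p := by
        ext y
        rw [mem_filter, mem_image]
        constructor
        · rintro ⟨hy, hy2⟩
          rw [himg, mem_image] at hy
          obtain ⟨s, hs, rfl⟩ := hy
          rw [mem_range] at hs
          have : s ≠ 2 * m := by rintro rfl; exact hy2.ne rfl
          refine ⟨s, ?_, rfl⟩
          rw [hY, mem_filter, mem_range]
          exact ⟨by omega, hy2.symm⟩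
        · rintro ⟨t, ht, rfl⟩
          rw [hY, mem_filter, mem_range] at ht
          exact ⟨hpA _ (by omega), ht.2.symm⟩
      unfold dg; rw [this, card_image_of_injOn]
      intro s hs t ht h
      simp only [hY, coe_filter, mem_range, Set.mem_ofPred_eq] at hs ht
      exact hinj _ _ (by omega) (by omega) h
    have hdisj : Disjoint X Y := by
      rw [disjoint_left]
      intro t h1 h2
      rw [hX, mem_filter, mem_range] at h1
      rw [hY, mem_filter, mem_range] at h2
      exact hcr t h1.1 h1.2 h2.2
    have hsum : X.card + Y.card ≤ 2 * m := by
      rw [← card_union_of_disjoint hdisj]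
      calc _ ≤ (range (2 * m)).card := card_le_card (union_subset (filter_subset _ _) (filter_subset _ _))
        _ = _ := card_range _
    have hXm : X.card ≤ m := by omega
    have hX1 : 1 ≤ X.card := by
      by_contra h0
      have := h 1 le_rfl hm
      rw [Nat.lt_one_iff, card_eq_zero, filter_eq_empty_iff] at this
      exact this (hpA 0 (by omega)) (by omega)
    have := h X.card hX1 hXm
    have h2 : X.card ≤ (A.filter fun v => dg G A v ≤ X.card).card := by
      apply card_le_card_of_injOn p
      · intro t ht
        have ht' := ht
        simp only [hX, coe_filter, mem_range, Set.mem_ofPred_eq] at ht'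
        simp only [coe_filter, Set.mem_ofPred_eq]
        refine ⟨hpA _ (by omega), ?_⟩
        rw [← hXc]
        apply hmax _ (hpA _ (by omega))
        · intro h; have := hinj _ _ (by omega) (by omega) h; omega
        · intro h; exact hcr t ht'.1 ht'.2 h
      · intro s hs t ht h
        simp only [hX, coe_filter, mem_range, Set.mem_ofPred_eq] at hs ht
        exact hinj _ _ (by omega) (by omega) h
    omega

theorem posa {m : ℕ} (hm : 1 ≤ m) {A : Finset U} (hA : A.card = 2 * m + 1) (G : SimpleGraph U)
    (h : ∀ i, 1 ≤ i → i ≤ m → (A.filter fun v => dg G A v ≤ i).card < i) :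
    ∃ c, SCyc m G A c := by
  suffices H : ∀ k, ∀ G : SimpleGraph U,
      (∀ i, 1 ≤ i → i ≤ m → (A.filter fun v => dg G A v ≤ i).card < i) →
      ((A ×ˢ A).filter fun x => ¬ G.Adj x.1 x.2).card = k → ∃ c, SCyc m G A c from H _ G h rfl
  clear h G
  intro k
  induction k using Nat.strong_induction_on with
  | _ k ih =>
  intro G h hk
  set B := (A ×ˢ A).filter fun x => ¬ G.Adj x.1 x.2 ∧ x.1 ≠ x.2 with hB
  by_cases hBe : B = ∅
  · -- complete
    have hcomp : ∀ u ∈ A, ∀ v ∈ A, u ≠ v → G.Adj u v := by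
      intro u hu v hv huv
      by_contra hn
      have : (u, v) ∈ B := by simp [hB, hu, hv, huv, hn]
      rw [hBe] at this; simp at this
    have e : ZMod (2 * m + 1) ≃ A := Fintype.equivOfCardEq (by simp [hA])
    refine ⟨fun i => e i, ?_, fun i => (e i).2, fun i => ?_⟩
    · intro i j hij; exact e.injective (Subtype.ext hij)
    · apply hcomp _ (e i).2 _ (e _).2
      intro heq
      have := e.injective (Subtype.ext heq)
      have h1 : (1 : ZMod (2 * m + 1)) = 0 := by linear_combination -this
      apply zmod_two_ne hm; rw [h1]; ring
  · obtain ⟨x, hx, hmax⟩ := exists_max_image B (fun x => dg G A x.1 + dg G A x.2)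
      (nonempty_iff_ne_empty.2 hBe)
    have : ∃ u v, u ∈ A ∧ v ∈ A ∧ u ≠ v ∧ ¬ G.Adj u v ∧ dg G A u ≤ dg G A v ∧
        ∀ w ∈ A, w ≠ v → ¬ G.Adj w v → dg G A w ≤ dg G A u := by
      rw [hB, mem_filter, mem_product] at hx
      obtain ⟨⟨h1, h2⟩, h3, h4⟩ := hx
      rcases le_total (dg G A x.1) (dg G A x.2) with hl | hl
      · refine ⟨x.1, x.2, h1, h2, h4, h3, hl, ?_⟩
        intro w hw hne hna
        have := hmax (w, x.2) (by simp [hB, hw, h2, hne, hna])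
        simp only at this; omega
      · refine ⟨x.2, x.1, h2, h1, h4.symm, fun h => h3 h.symm, hl, ?_⟩
        intro w hw hne hna
        have := hmax (w, x.1) (by simp [hB, hw, h1, hne, hna])
        simp only at this; omega
    obtain ⟨u, v, hu, hv, huv, hnuv, hle, hmx⟩ := this
    clear hmax hx x
    obtain ⟨c, hc⟩ := ih ((A ×ˢ A).filter fun x => ¬ (addE G u v).Adj x.1 x.2).card (by
      rw [← hk]
      apply card_lt_card
      refine ⟨?_, ?_⟩
      · intro y hy; rw [mem_filter] at hy ⊢
        exact ⟨hy.1, fun hh => hy.2 (Or.inl hh)⟩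
      · intro hsub
        have : (u, v) ∈ (A ×ˢ A).filter fun x => ¬ G.Adj x.1 x.2 := by simp [hu, hv, hnuv]
        have := (mem_filter.1 (hsub this)).2
        exact this (Or.inr ⟨huv, Or.inl ⟨rfl, rfl⟩⟩)) (addE G u v) (by
      intro i h1 h2
      refine lt_of_le_of_lt (card_le_card ?_) (h i h1 h2)
      intro y hy; rw [mem_filter] at hy ⊢
      refine ⟨hy.1, ?_⟩
      have := dg_addE G A huv hnuv y
      omega) rfl
    obtain ⟨cinj, cA, cadj⟩ := hc
    by_cases hG : ∀ i, G.Adj (c i) (c (i + 1))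
    · exact ⟨c, cinj, cA, hG⟩
    push Not at hG
    obtain ⟨i, hi⟩ := hG
    have key : (c i = u ∧ c (i + 1) = v) ∨ (c i = v ∧ c (i + 1) = u) := by
      rcases cadj i with h1 | h1
      · exact absurd h1 hi
      · exact h1.2
    have hoth : ∀ j, j ≠ i → G.Adj (c j) (c (j + 1)) := by
      intro j hj
      rcases cadj j with h1 | ⟨_, h1⟩
      · exact h1
      exfalso
      have h2 : c j = c i ∨ (c j = c (i + 1) ∧ c (j + 1) = c i) := by
        rcases key with ⟨k1, k2⟩ | ⟨k1, k2⟩ <;> rcases h1 with ⟨l1, l2⟩ | ⟨l1, l2⟩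
        · left; rw [k1, l1]
        · right; rw [k1, k2, l1, l2]; exact ⟨rfl, rfl⟩
        · right; rw [k1, k2, l1, l2]; exact ⟨rfl, rfl⟩
        · left; rw [k1, l1]
      rcases h2 with h2 | ⟨h2, h3⟩
      · exact hj (cinj h2)
      · have h2 := cinj h2
        have h3 := cinj h3
        apply zmod_two_ne hm
        rw [h2] at h3
        linear_combination h3
    rcases key with ⟨k1, k2⟩ | ⟨k1, k2⟩
    · -- c i = u, c (i+1) = v
      have e0 : c (i - ((0 : ℕ) : ZMod (2 * m + 1))) = u := by rw [← k1]; congr 1; simp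
      have e1 : c (i - ((2 * m : ℕ) : ZMod (2 * m + 1))) = v := by
        rw [← k2, zmod_cast_2m]; congr 1; ring
      apply posa_core hm hA h (fun t : ℕ => c (i - (t : ZMod (2 * m + 1))))
      · intro s _; exact cA _
      · intro s t hs ht heq
        have := cinj heq
        apply zmod_cast_inj hs ht
        linear_combination -this
      · intro s hs
        have := hoth (i - ((s + 1 : ℕ) : ZMod (2 * m + 1))) (by
          intro heq
          have h0 : ((s + 1 : ℕ) : ZMod (2 * m + 1)) = (0 : ℕ) := by
            push_cast at heq ⊢; linear_combination -heq
          have := zmod_cast_inj (by omega) (by omega) h0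
          omega)
        have e : i - ((s + 1 : ℕ) : ZMod (2 * m + 1)) + 1 = i - (s : ZMod (2 * m + 1)) := by
          push_cast; ring
        rw [e] at this
        exact this.symm
      · simp only [e0, e1]; exact hle
      · simp only [e0, e1]; exact hmx
      · simp only [e0, e1]; exact hnuv
    · have e0 : c (i + 1 + ((0 : ℕ) : ZMod (2 * m + 1))) = u := by rw [← k2]; congr 1; simp
      have e1 : c (i + 1 + ((2 * m : ℕ) : ZMod (2 * m + 1))) = v := by
        rw [← k1, zmod_cast_2m]; congr 1; ring
      apply posa_core hm hA h (fun t : ℕ => c (i + 1 + (t : ZMod (2 * m + 1))))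
      · intro s _; exact cA _
      · intro s t hs ht heq
        have := cinj heq
        apply zmod_cast_inj hs ht
        linear_combination this
      · intro s hs
        have := hoth (i + 1 + (s : ZMod (2 * m + 1))) (by
          intro heq
          have h0 : ((s + 1 : ℕ) : ZMod (2 * m + 1)) = (0 : ℕ) := by
            push_cast at heq ⊢; linear_combination heq
          have := zmod_cast_inj (by omega) (by omega) h0
          omega)
        have e : i + 1 + (s : ZMod (2 * m + 1)) + 1 = i + 1 + ((s + 1 : ℕ) : ZMod (2 * m + 1)) := by
          push_cast; ring
        rw [e] at this
        exact this
      · simp only [e0, e1]; exact hle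
      · simp only [e0, e1]; exact hmx
      · simp only [e0, e1]; exact hnuv

end Posa

section Bondy
open Classical Finset

variable {U : Type*}

/-- Cycle of length `l` in `G` with vertices in `A`. -/
def CycIn (G : SimpleGraph U) (A : Finset U) (l : ℕ) : Prop :=
  ∃ q : ℕ → U, (∀ s, s < l → q s ∈ A) ∧ (∀ s t, s < l → t < l → q s = q t → s = t) ∧
    (∀ s, s + 1 < l → G.Adj (q s) (q (s + 1))) ∧ G.Adj (q (l - 1)) (q 0)

theorem CycIn.mono {G H : SimpleGraph U} {A B : Finset U} {l : ℕ} (hl : 1 ≤ l) (h : CycIn G A l)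
    (hAB : A ⊆ B)
    (hGH : ∀ u ∈ A, ∀ v ∈ A, G.Adj u v → H.Adj u v) : CycIn H B l := by
  obtain ⟨q, h1, h2, h3, h4⟩ := h
  exact ⟨q, fun s hs => hAB (h1 s hs), h2, fun s hs => hGH _ (h1 _ (by omega)) _ (h1 _ hs) (h3 s hs),
    hGH _ (h1 _ (by omega)) _ (h1 _ (by omega)) h4⟩

theorem CycIn.walk {G : SimpleGraph U} {A : Finset U} {l : ℕ} (hl : 3 ≤ l) (h : CycIn G A l) :
    hasCycleOfLength G l := by
  obtain ⟨q, -, hinj, hadj, hlast⟩ := h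
  have H : ∀ k, k < l → ∃ p : G.Walk (q 0) (q k), p.IsPath ∧ p.length = k ∧
      (∀ x ∈ p.support, ∃ s, s ≤ k ∧ x = q s) ∧
      ∀ e ∈ p.edges, ∃ s, s < k ∧ e = s(q s, q (s + 1)) := by
    intro k
    induction k with
    | zero =>
      intro _
      refine ⟨SimpleGraph.Walk.nil, by simp, by simp, ?_, by simp⟩
      intro x hx; exact ⟨0, le_rfl, by simpa using hx⟩
    | succ k ih =>
      intro hk
      obtain ⟨p, p1, p2, p3, p4⟩ := ih (by omega)
      refine ⟨p.concat (hadj k hk), ?_, ?_, ?_, ?_⟩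
      · apply p1.concat
        intro hmem
        obtain ⟨s, hs, he⟩ := p3 _ hmem
        have := hinj _ _ hk (by omega) he
        omega
      · simp [p2]
      · intro x hx
        rw [SimpleGraph.Walk.support_concat] at hx
        simp only [List.concat_eq_append, List.mem_append, List.mem_singleton] at hx
        rcases hx with hx | hx
        · obtain ⟨s, hs, he⟩ := p3 _ hx
          exact ⟨s, by omega, he⟩
        · exact ⟨k + 1, le_rfl, hx⟩
      · intro e he
        rw [SimpleGraph.Walk.edges_concat] at he
        simp only [List.concat_eq_append, List.mem_append, List.mem_singleton] at he
        rcases he with hx | hx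
        · obtain ⟨s, hs, he⟩ := p4 _ hx
          exact ⟨s, by omega, he⟩
        · exact ⟨k, by omega, hx⟩
  obtain ⟨p, p1, p2, p3, p4⟩ := H (l - 1) (by omega)
  refine ⟨_, SimpleGraph.Walk.cons hlast p, ?_, by simp [p2]; omega⟩
  rw [SimpleGraph.Walk.cons_isCycle_iff]
  refine ⟨p1, fun hmem => ?_⟩
  obtain ⟨s, hs, he⟩ := p4 _ hmem
  rw [Sym2.eq_iff] at he
  rcases he with ⟨h1, h2⟩ | ⟨h1, h2⟩
  · have := hinj _ _ (by omega) (by omega) h1; omega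
  · have := hinj _ _ (by omega) (by omega) h1
    have := hinj _ _ (by omega) (by omega) h2; omega

/-- Twice the number of edges inside `S`. -/
noncomputable def E2 (G : SimpleGraph U) (S : Finset U) : ℕ := ∑ v ∈ S, dg G S v

theorem bondy {m : ℕ} (hm : 1 ≤ m) {A : Finset U} {G : SimpleGraph U} {c : ZMod (2 * m + 1) → U}
    (hc : SCyc m G A c) (hE : 2 * m ^ 2 + 2 * m + 2 ≤ E2 G (univ.image c)) (l : ℕ) (hl : 3 ≤ l)
    (hl2 : l ≤ 2 * m + 1) : CycIn G A l := by
  obtain ⟨cinj, cA, cadj⟩ := hc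
  set S := univ.image c with hS
  have hsum : E2 G S = ∑ i, dg G S (c i) := by
    unfold E2; rw [hS, sum_image (fun _ _ _ _ h => cinj h)]
  have hsum2 : E2 G S = ∑ i, dg G S (c (i + 1)) := by
    rw [hsum]; exact (Equiv.sum_comp (Equiv.addRight (1 : ZMod (2 * m + 1))) fun i => dg G S (c i)).symm
  have hex : ∃ i, 2 * m + 2 ≤ dg G S (c (i + 1)) + dg G S (c i) := by
    by_contra hcon
    push Not at hcon
    have : ∑ i, (dg G S (c (i + 1)) + dg G S (c i)) ≤ ∑ i : ZMod (2 * m + 1), (2 * m + 1) :=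
      sum_le_sum fun i _ => by have := hcon i; omega
    rw [sum_add_distrib, ← hsum, ← hsum2] at this
    simp only [sum_const, card_univ, ZMod.card, smul_eq_mul] at this
    nlinarith
  obtain ⟨i, hi⟩ := hex
  set w : ℕ → U := fun t => c (i + 1 + (t : ZMod (2 * m + 1))) with hw
  have w0 : w 0 = c (i + 1) := by simp [hw]
  have wl : w (2 * m) = c i := by simp only [hw]; rw [zmod_cast_2m]; congr 1; ring
  have winj : ∀ s t, s ≤ 2 * m → t ≤ 2 * m → w s = w t → s = t := by
    intro s t hs ht heq
    apply zmod_cast_inj (m := m) (by omega) (by omega)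
    have := cinj heq
    linear_combination this
  have wadj : ∀ s, G.Adj (w s) (w (s + 1)) := by
    intro s
    have := cadj (i + 1 + (s : ZMod (2 * m + 1)))
    simp only [hw]; push_cast; rw [← add_assoc]; exact this
  have wcl : G.Adj (w (2 * m)) (w 0) := by rw [w0, wl]; exact cadj i
  have wS : ∀ v ∈ S, ∃ t, t ≤ 2 * m ∧ v = w t := by
    intro v hv
    rw [hS, mem_image] at hv
    obtain ⟨j, -, rfl⟩ := hv
    refine ⟨(j - (i + 1)).val, ?_, ?_⟩
    · have := ZMod.val_lt (j - (i + 1)); omega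
    · simp only [hw, ZMod.natCast_zmod_val]; congr 1; ring
  set X := (Icc 1 (2 * m - 1)).filter fun t => G.Adj (w 0) (w t) with hX
  set Y := (Icc 1 (2 * m - 1)).filter fun t => G.Adj (w (2 * m)) (w t) with hY
  have hXc : dg G S (w 0) ≤ X.card + 1 := by
    have : S.filter (G.Adj (w 0)) ⊆ insert (w (2 * m)) (X.image w) := by
      intro v hv
      rw [mem_filter] at hv
      obtain ⟨t, ht, rfl⟩ := wS v hv.1
      rw [mem_insert]
      by_cases h1 : t = 2 * m
      · left; rw [h1]
      · right
        have : t ≠ 0 := by rintro rfl; exact hv.2.ne rfl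
        apply mem_image_of_mem
        rw [hX, mem_filter, mem_Icc]; exact ⟨by omega, hv.2⟩
    calc _ ≤ _ := card_le_card this
      _ ≤ (X.image w).card + 1 := card_insert_le _ _
      _ ≤ _ := by gcongr; exact card_image_le
  have hYc : dg G S (w (2 * m)) ≤ Y.card + 1 := by
    have : S.filter (G.Adj (w (2 * m))) ⊆ insert (w 0) (Y.image w) := by
      intro v hv
      rw [mem_filter] at hv
      obtain ⟨t, ht, rfl⟩ := wS v hv.1
      rw [mem_insert]
      by_cases h1 : t = 0
      · left; rw [h1]
      · right
        have : t ≠ 2 * m := by rintro rfl; exact hv.2.ne rfl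
        apply mem_image_of_mem
        rw [hY, mem_filter, mem_Icc]; exact ⟨by omega, hv.2⟩
    calc _ ≤ _ := card_le_card this
      _ ≤ (Y.image w).card + 1 := card_insert_le _ _
      _ ≤ _ := by gcongr; exact card_image_le
  set φ : ℕ → ℕ := fun t => if t ≤ 2 * m + 2 - l then t + l - 3 else t + l - (2 * m + 2) with hφ
  have hmeet : ∃ t ∈ X, φ t ∈ Y := by
    by_contra hcon
    push Not at hcon
    have hd : Disjoint (X.image φ) Y := by
      rw [disjoint_left]
      intro k hk
      rw [mem_image] at hk
      obtain ⟨t, ht, rfl⟩ := hk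
      exact hcon t ht
    have hXi : (X.image φ).card = X.card := by
      apply card_image_of_injOn
      intro s hs t ht heq
      simp only [hX, coe_filter, mem_Icc, Set.mem_ofPred_eq] at hs ht
      simp only [hφ] at heq
      split_ifs at heq <;> omega
    have hsub : X.image φ ∪ Y ⊆ Icc 1 (2 * m - 1) := by
      apply union_subset _ (filter_subset _ _)
      intro k hk
      rw [mem_image] at hk
      obtain ⟨t, ht, rfl⟩ := hk
      rw [hX, mem_filter, mem_Icc] at ht
      rw [mem_Icc]
      simp only [hφ]
      split_ifs <;> omega
    have := card_le_card hsub
    rw [card_union_of_disjoint hd, hXi, Nat.card_Icc] at this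
    rw [w0] at hXc; rw [wl] at hYc
    omega
  obtain ⟨t, htX, htY⟩ := hmeet
  rw [hX, mem_filter, mem_Icc] at htX
  rw [hY, mem_filter, mem_Icc] at htY
  obtain ⟨ht1, ht2⟩ := htX
  obtain ⟨hk1, hk2⟩ := htY
  have hmk : ∀ g : ℕ → ℕ, (∀ s, s < l → g s ≤ 2 * m) →
      (∀ s s', s < l → s' < l → g s = g s' → s = s') →
      (∀ s, s + 1 < l → G.Adj (w (g s)) (w (g (s + 1)))) →
      G.Adj (w (g (l - 1))) (w (g 0)) → CycIn G A l := by
    intro g g1 g2 g3 g4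
    exact ⟨fun s => w (g s), fun s _ => cA _, fun s s' hs hs' h =>
      g2 s s' hs hs' (winj _ _ (g1 s hs) (g1 s' hs') h), g3, g4⟩
  by_cases hcase : t ≤ 2 * m + 2 - l
  · have hφt : φ t = t + l - 3 := by simp [hφ, hcase]
    rw [hφt] at hk1 hk2
    apply hmk fun s => if s = 0 then 0 else if s = l - 1 then 2 * m else t + s - 1
    · intro s hs; split_ifs <;> omega
    · intro s s' hs hs' h; split_ifs at h <;> omega
    · intro s hs
      by_cases h0 : s = 0
      · subst h0
        rw [if_pos rfl, if_neg (by omega), if_neg (by omega)]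
        simpa using ht2
      · rw [if_neg h0, if_neg (by omega), if_neg (by omega)]
        by_cases h1 : s + 1 = l - 1
        · rw [if_pos h1]
          have : t + s - 1 = t + l - 3 := by omega
          rw [this]; exact hk2.symm
        · rw [if_neg h1]
          have : t + (s + 1) - 1 = (t + s - 1) + 1 := by omega
          rw [this]; exact wadj _
    · rw [if_neg (by omega), if_pos rfl, if_pos rfl]; exact wcl
  · have hφt : φ t = t + l - (2 * m + 2) := by simp [hφ, hcase]
    rw [hφt] at hk1 hk2
    set k := t + l - (2 * m + 2) with hk
    apply hmk fun s => if s ≤ k then s else 2 * m + 1 + k - s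
    · intro s hs; split_ifs <;> omega
    · intro s s' hs hs' h; split_ifs at h <;> omega
    · intro s hs
      rcases lt_trichotomy s k with h | h | h
      · rw [if_pos (by omega), if_pos (by omega)]; exact wadj s
      · rw [if_pos (by omega), if_neg (by omega)]
        have : 2 * m + 1 + k - (s + 1) = 2 * m := by omega
        rw [this, h]; exact hk2.symm
      · rw [if_neg (by omega), if_neg (by omega)]
        have : 2 * m + 1 + k - s = (2 * m + 1 + k - (s + 1)) + 1 := by omega
        rw [this]; exact (wadj _).symm
    · rw [if_neg (by omega), if_pos (by omega)]
      have : 2 * m + 1 + k - (l - 1) = t := by omega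
      rw [this]; exact ht2.symm

end Bondy

section EG
open Classical Finset

variable {U : Type*}

theorem eg_improve [Fintype U] {A Hd : Finset U} {d : U → ℕ} {a : U} (hHd : Hd ⊆ A) (ha : a ∈ A)
    (haH : a ∉ Hd) (htop : ∀ v ∈ Hd, d a ≤ d v) (heven : Even (∑ v ∈ A, d v))
    (hEG : ∀ P ⊆ A, P.Nonempty → ∑ v ∈ P, d v ≤ P.card * (P.card - 1) +
      ∑ v ∈ A \ P, min P.card (d v)) (G : SimpleGraph U) (hle : ∀ v ∈ A, dg G A v ≤ d v)
    (hsat : ∀ v ∈ Hd, dg G A v = d v) (hlt : dg G A a < d a) :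
    ∃ G' : SimpleGraph U, (∀ v ∈ A, dg G' A v ≤ d v) ∧ (∀ v ∈ Hd, dg G' A v = d v) ∧
      dg G A a < dg G' A a := by
  by_contra hno
  have hno' : ∀ G' : SimpleGraph U, (∀ v ∈ A, dg G' A v ≤ d v) → (∀ v ∈ Hd, dg G' A v = d v) →
      dg G A a < dg G' A a → False := fun G' h1 h2 h3 => hno ⟨G', h1, h2, h3⟩
  clear hno
  have ne_a : ∀ v ∈ Hd, v ≠ a := fun v hv h => haH (h ▸ hv)
  -- (i)
  have f1 : ∀ t ∈ A, t ∉ Hd → t ≠ a → ¬ G.Adj a t → dg G A t = d t := by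
    intro t ht htH hta hna
    by_contra hns
    have := hle t ht
    have e : ∀ w, _ := fun w => dg_addE G A hta.symm hna w
    simp only [ha, ht, and_true] at e
    refine hno' (addE G a t) (fun v hv => ?_) (fun v hv => ?_) ?_
    · have := e v; have := hle v hv; grind
    · have := e v; have := hsat v hv; grind
    · have := e a; grind
  have f2 : ∀ t ∈ A, t ∉ Hd → t ≠ a → ¬ G.Adj a t → ∀ w ∈ A, w ∉ Hd → w ≠ a → ¬ G.Adj t w := by
    intro t ht htH hta hna w hw hwH hwa htw
    have hne := htw.ne
    have e1 : ∀ x, _ := fun x => dg_delE G A htw x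
    have e2 : ∀ x, _ := fun x => dg_addE (delE G t w) A hta.symm (fun h => hna h.1) x
    simp only [ha, ht, hw, and_true] at e1 e2
    refine hno' (addE (delE G t w) a t) (fun v hv => ?_) (fun v hv => ?_) ?_
    · have := e1 v; have := e2 v; have := hle v hv; grind
    · have := e1 v; have := e2 v; have := hsat v hv; grind
    · have := e1 a; have := e2 a; grind
  -- (ii)
  have f3 : ∀ v ∈ Hd, ∃ u ∈ A, G.Adj v u ∧ u ≠ a ∧ ¬ G.Adj a u := by
    intro v hv
    by_contra hcon
    push Not at hcon
    have hva := ne_a v hv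
    have hsub : (A.filter (G.Adj v)).erase a ⊆ (A.filter (G.Adj a)).erase v := by
      intro u hu
      simp only [mem_erase, mem_filter] at hu ⊢
      exact ⟨hu.2.2.ne', hu.2.1, hcon u hu.2.1 hu.2.2 hu.1⟩
    have h1 := card_le_card hsub
    have h2 := hsat v hv
    have h3 := htop v hv
    unfold dg at h2 hlt
    rw [card_erase_eq_ite, card_erase_eq_ite] at h1
    simp only [mem_filter, ha, hHd hv, true_and, G.adj_comm v a] at h1
    by_cases hadj : G.Adj a v
    · have := card_pos.2 ⟨v, mem_filter.2 ⟨hHd hv, hadj⟩⟩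
      rw [if_pos hadj, if_pos hadj] at h1
      omega
    · rw [if_neg hadj, if_neg hadj] at h1
      omega
  have f4 : ∀ v ∈ Hd, ∀ t ∈ A, t ∉ Hd → t ≠ a → ¬ G.Adj v t → dg G A t = d t := by
    intro v hv t ht htH hta hna
    obtain ⟨u, huA, hvu, hua, hau⟩ := f3 v hv
    have hva := ne_a v hv
    have hvA := hHd hv
    have hvt : v ≠ t := fun h => htH (h ▸ hv)
    have hut : u ≠ t := fun h => hna (h ▸ hvu)
    have huv := hvu.ne
    by_contra hns
    have := hle t ht
    have e1 : ∀ x, _ := fun x => dg_delE G A hvu x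
    have e2 : ∀ x, _ := fun x => dg_addE (delE G v u) A hua.symm (fun h => hau h.1) x
    have e3 : ∀ x, _ := fun x => dg_addE (addE (delE G v u) a u) A hvt (by
      rintro (h | ⟨_, h | h⟩)
      · exact hna h.1
      · exact hva h.1
      · exact hta h.2) x
    simp only [ha, ht, huA, hvA, and_true] at e1 e2 e3
    refine hno' (addE (addE (delE G v u) a u) v t) (fun x hx => ?_) (fun x hx => ?_) ?_
    · have := e1 x; have := e2 x; have := e3 x; have := hle x hx; grind
    · have := e1 x; have := e2 x; have := e3 x; have := hsat x hx; grind
    · have := e1 a; have := e2 a; have := e3 a; grind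
  have f5 : ∀ v ∈ Hd, ∀ t ∈ A, t ∉ Hd → t ≠ a → ¬ G.Adj v t →
      ∀ w ∈ A, w ∉ Hd → w ≠ a → ¬ G.Adj t w := by
    intro v hv t ht htH hta hna w hw hwH hwa htw
    obtain ⟨u, huA, hvu, hua, hau⟩ := f3 v hv
    have hva := ne_a v hv
    have hvA := hHd hv
    have hvt : v ≠ t := fun h => htH (h ▸ hv)
    have hvw : v ≠ w := fun h => hwH (h ▸ hv)
    have hut : u ≠ t := fun h => hna (h ▸ hvu)
    have huv := hvu.ne
    have htw' := htw.ne
    have e0 : ∀ x, _ := fun x => dg_delE G A htw x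
    set G0 := delE G t w with hG0
    have hvu0 : G0.Adj v u := ⟨hvu, by tauto⟩
    have e1 : ∀ x, _ := fun x => dg_delE G0 A hvu0 x
    have e2 : ∀ x, _ := fun x => dg_addE (delE G0 v u) A hua.symm (fun h => hau h.1.1) x
    have e3 : ∀ x, _ := fun x => dg_addE (addE (delE G0 v u) a u) A hvt (by
      rintro (h | ⟨_, h | h⟩)
      · exact hna h.1.1
      · exact hva h.1
      · exact hta h.2) x
    simp only [ha, ht, huA, hvA, hw, and_true] at e0 e1 e2 e3
    refine hno' (addE (addE (delE G0 v u) a u) v t) (fun x hx => ?_) (fun x hx => ?_) ?_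
    · have := e0 x; have := e1 x; have := e2 x; have := e3 x; have := hle x hx; grind
    · have := e0 x; have := e1 x; have := e2 x; have := e3 x; have := hsat x hx; grind
    · have := e0 a; have := e1 a; have := e2 a; have := e3 a; grind
  -- (iv)
  have f6 : ∀ v ∈ Hd, G.Adj a v := by
    intro v hv
    by_contra hna
    obtain ⟨u, huA, hvu, hua, hau⟩ := f3 v hv
    have hva := ne_a v hv
    have hvA := hHd hv
    have huv := hvu.ne
    have e1 : ∀ x, _ := fun x => dg_delE G A hvu x
    have e2 : ∀ x, _ := fun x => dg_addE (delE G v u) A hua.symm (fun h => hau h.1) x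
    have hn3 : ¬ (addE (delE G v u) a u).Adj a v := by
      rintro (h | ⟨_, h | h⟩)
      · exact hna h.1
      · exact huv h.2
      · exact hva h.2
    have e3 : ∀ x, _ := fun x => dg_addE (addE (delE G v u) a u) A hva.symm hn3 x
    set G3 := addE (addE (delE G v u) a u) a v with hG3
    simp only [ha, huA, hvA, and_true] at e1 e2 e3
    by_cases hdef : dg G A a + 2 ≤ d a
    · refine hno' G3 (fun x hx => ?_) (fun x hx => ?_) ?_
      · have := e1 x; have := e2 x; have := e3 x; have := hle x hx; grind
      · have := e1 x; have := e2 x; have := e3 x; have := hsat x hx; grind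
      · have := e1 a; have := e2 a; have := e3 a; grind
    by_cases htn : ∃ w ∈ A, w ∉ Hd ∧ w ≠ a ∧ G.Adj a w
    · obtain ⟨w, hw, hwH, hwa, haw⟩ := htn
      have haw3 : G3.Adj a w := Or.inl (Or.inl ⟨haw, by tauto⟩)
      have hvw : v ≠ w := fun h => hwH (h ▸ hv)
      have hwu : u ≠ w := fun h => hau (h ▸ haw)
      have e4 : ∀ x, _ := fun x => dg_delE G3 A haw3 x
      simp only [ha, hw, and_true] at e4
      refine hno' (delE G3 a w) (fun x hx => ?_) (fun x hx => ?_) ?_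
      · have := e1 x; have := e2 x; have := e3 x; have := e4 x; have := hle x hx; grind
      · have := e1 x; have := e2 x; have := e3 x; have := e4 x; have := hsat x hx; grind
      · have := e1 a; have := e2 a; have := e3 a; have := e4 a; grind
    · push Not at htn
      have hall : ∀ t ∈ A.erase a, dg G A t = d t := by
        intro t ht
        rw [mem_erase] at ht
        by_cases htH : t ∈ Hd
        · exact hsat t htH
        · exact f1 t ht.2 htH ht.1 (htn t ht.2 htH ht.1)
      have h1 := sum_dg_even G A
      have hs : ∑ x ∈ A.erase a, dg G A x = ∑ x ∈ A.erase a, d x := sum_congr rfl hall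
      rw [← add_sum_erase A _ ha, hs] at h1
      rw [← add_sum_erase A _ ha] at heven
      beta_reduce at h1 heven
      have : d a = dg G A a + 1 := by omega
      rw [this] at heven
      obtain ⟨p, hp⟩ := h1
      obtain ⟨q, hq⟩ := heven
      omega
  have tail : ∀ u ∈ A, u ≠ a → ¬ G.Adj a u → u ∉ Hd := fun u _ _ h2 h3 => h2 (f6 u h3)
  have f7 : ∀ v ∈ Hd, ∀ v' ∈ Hd, v ≠ v' → G.Adj v v' := by
    intro v hv v' hv' hne
    by_contra hna
    obtain ⟨u, huA, hvu, hua, hau⟩ := f3 v hv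
    obtain ⟨u', huA', hvu', hua', hau'⟩ := f3 v' hv'
    have hva := ne_a v hv
    have hvA := hHd hv
    have hva' := ne_a v' hv'
    have hvA' := hHd hv'
    have huH := tail u huA hua hau
    have huH' := tail u' huA' hua' hau'
    have n1 : u ≠ v := fun h => huH (h ▸ hv)
    have n2 : u ≠ v' := fun h => huH (h ▸ hv')
    have n3 : u' ≠ v := fun h => huH' (h ▸ hv)
    have n4 : u' ≠ v' := fun h => huH' (h ▸ hv')
    have e0 : ∀ x, _ := fun x => dg_delE G A hvu x
    set G0 := delE G v u with hG0
    have hvu0 : G0.Adj v' u' := ⟨hvu', by rintro (h | h); exacts [hne h.1.symm, n3 h.2]⟩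
    have e1 : ∀ x, _ := fun x => dg_delE G0 A hvu0 x
    have e2 : ∀ x, _ := fun x => dg_addE (delE G0 v' u') A hua.symm (fun h => hau h.1.1) x
    have e3 : ∀ x, _ := fun x => dg_addE (addE (delE G0 v' u') a u) A hne (by
      rintro (h | ⟨_, h | h⟩)
      · exact hna h.1.1
      · exact hva h.1
      · exact hva' h.2) x
    simp only [ha, huA, hvA, huA', hvA', and_true] at e0 e1 e2 e3
    refine hno' (addE (addE (delE G0 v' u') a u) v v') (fun x hx => ?_) (fun x hx => ?_) ?_
    · have := e0 x; have := e1 x; have := e2 x; have := e3 x; have := hle x hx; grind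
    · have := e0 x; have := e1 x; have := e2 x; have := e3 x; have := hsat x hx; grind
    · have := e0 a; have := e1 a; have := e2 a; have := e3 a; grind
  -- conclusion
  set P := insert a Hd with hP
  have hPA : P ⊆ A := insert_subset ha hHd
  have hcl : ∀ p ∈ P, ∀ q ∈ P, p ≠ q → G.Adj p q := by
    intro p hp q hq hpq
    rcases mem_insert.1 hp with rfl | hp' <;> rcases mem_insert.1 hq with rfl | hq'
    · exact absurd rfl hpq
    · exact f6 q hq'
    · exact (f6 p hp').symm
    · exact f7 p hp' q hq' hpq
  have h1 := hEG P hPA ⟨a, mem_insert_self _ _⟩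
  have h2 : ∑ v ∈ P, dg G A v = ∑ v ∈ P, dg G P v + ∑ v ∈ A \ P, dg G P v := by
    rw [dg_comm G (A \ P) P, ← sum_add_distrib]; exact sum_congr rfl fun v _ => dg_split G hPA v
  have h3 : P.card * (P.card - 1) ≤ ∑ v ∈ P, dg G P v := by
    rw [← smul_eq_mul]; apply card_nsmul_le_sum
    intro v hv
    unfold dg
    rw [← card_erase_of_mem hv]
    apply card_le_card
    intro q hq
    rw [mem_erase] at hq
    exact mem_filter.2 ⟨hq.2, hcl v hv q hq.2 hq.1.symm⟩
  have h4 : ∑ v ∈ A \ P, min P.card (d v) ≤ ∑ v ∈ A \ P, dg G P v := by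
    apply sum_le_sum
    intro t ht
    rw [mem_sdiff, hP, mem_insert] at ht
    push Not at ht
    obtain ⟨htA, hta, htH⟩ := ht
    by_cases hall : ∀ p ∈ P, G.Adj t p
    · have : dg G P t = P.card := by unfold dg; rw [filter_true_of_mem hall]
      omega
    · push Not at hall
      obtain ⟨p, hp, hnp⟩ := hall
      have h5 : dg G A t = d t ∧ ∀ w ∈ A, w ∉ Hd → w ≠ a → ¬ G.Adj t w := by
        rcases mem_insert.1 hp with rfl | hp'
        · exact ⟨f1 t htA htH hta (fun h => hnp h.symm), f2 t htA htH hta (fun h => hnp h.symm)⟩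
        · exact ⟨f4 p hp' t htA htH hta (fun h => hnp h.symm),
            f5 p hp' t htA htH hta (fun h => hnp h.symm)⟩
      have h6 : dg G (A \ P) t = 0 := by
        unfold dg
        rw [card_eq_zero, filter_eq_empty_iff]
        intro w hw
        rw [mem_sdiff, hP, mem_insert] at hw
        push Not at hw
        exact h5.2 w hw.1 hw.2.2 hw.2.1
      have := dg_split G hPA t
      omega
  have h7 : ∑ v ∈ P, dg G A v < ∑ v ∈ P, d v :=
    sum_lt_sum (fun v hv => hle v (hPA hv)) ⟨a, mem_insert_self _ _, hlt⟩
  omega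

theorem eg [Fintype U] {A : Finset U} {d : U → ℕ} (heven : Even (∑ v ∈ A, d v))
    (hEG : ∀ P ⊆ A, P.Nonempty → ∑ v ∈ P, d v ≤ P.card * (P.card - 1) +
      ∑ v ∈ A \ P, min P.card (d v)) : ∃ G : SimpleGraph U, Rz G A d := by
  have H : ∀ k, k ≤ A.card → ∃ Hd ⊆ A, Hd.card = k ∧ (∀ v ∈ Hd, ∀ u ∈ A \ Hd, d u ≤ d v) ∧
      ∃ G : SimpleGraph U, (∀ v ∈ A, dg G A v ≤ d v) ∧ ∀ v ∈ Hd, dg G A v = d v := by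
    intro k
    induction k with
    | zero =>
      intro _
      refine ⟨∅, empty_subset _, rfl, by simp, ⊥, ?_, by simp⟩
      intro v _; unfold dg; simp
    | succ k ih =>
      intro hk
      obtain ⟨Hd, hHd, hc, ht, G, hG, hs⟩ := ih (by omega)
      have hne : (A \ Hd).Nonempty := by
        rw [← card_pos, card_sdiff_of_subset hHd]; omega
      obtain ⟨a, ha, hmax⟩ := exists_max_image (A \ Hd) d hne
      have ha' := mem_sdiff.1 ha
      refine ⟨insert a Hd, insert_subset ha'.1 hHd, by rw [card_insert_of_notMem ha'.2, hc], ?_, ?_⟩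
      · intro t htT u hu
        have hu' : u ∈ A \ Hd := by
          rw [mem_sdiff] at hu ⊢; exact ⟨hu.1, fun h => hu.2 (mem_insert_of_mem h)⟩
        rcases mem_insert.1 htT with rfl | h
        · exact hmax u hu'
        · exact ht t h u hu'
      · have key : ∀ j, ∀ G : SimpleGraph U, (∀ v ∈ A, dg G A v ≤ d v) → (∀ v ∈ Hd, dg G A v = d v) →
            d a - dg G A a = j →
            ∃ G : SimpleGraph U, (∀ v ∈ A, dg G A v ≤ d v) ∧ ∀ v ∈ insert a Hd, dg G A v = d v := by
          intro j
          induction j using Nat.strong_induction_on with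
          | _ j ihj =>
          intro G hG hs hj
          by_cases hlt : dg G A a < d a
          · obtain ⟨G', h1, h2, h3⟩ := eg_improve hHd ha'.1 ha'.2 (fun v hv => ht v hv a ha) heven hEG G hG hs hlt
            exact ihj _ (by omega) G' h1 h2 rfl
          · refine ⟨G, hG, fun v hv => ?_⟩
            rcases mem_insert.1 hv with rfl | h
            · have := hG v ha'.1; omega
            · exact hs v h
        exact key _ G hG hs rfl
  obtain ⟨Hd, hHd, hc, -, G, -, hs⟩ := H A.card le_rfl
  have := eq_of_subset_of_card_le hHd (by omega)
  subst this
  exact ⟨G, hs⟩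

end EG

section SL
open Classical Finset

variable {U : Type*}

theorem dg_delE_not_mem (G : SimpleGraph U) (S : Finset U) {u v : U} (h : G.Adj u v)
    (hu : u ∉ S) : E2 (delE G u v) S = E2 G S := by
  unfold E2
  apply sum_congr rfl
  intro w hw
  have := dg_delE G S h w
  have hwu : w ≠ u := fun h => hu (h ▸ hw)
  simp only [hu, hwu, and_false, false_and, if_false] at this
  omega

theorem E2_addE_not_mem (G : SimpleGraph U) (S : Finset U) {u v : U} (huv : u ≠ v)
    (h : ¬ G.Adj u v) (hu : u ∉ S) : E2 (addE G u v) S = E2 G S := by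
  unfold E2
  apply sum_congr rfl
  intro w hw
  have := dg_addE G S huv h w
  have hwu : w ≠ u := fun h => hu (h ▸ hw)
  simp only [hu, hwu, and_false, false_and, if_false] at this
  omega

theorem E2_delE (G : SimpleGraph U) (S : Finset U) {u v : U} (h : G.Adj u v) :
    E2 G S ≤ E2 (delE G u v) S + 2 := by
  unfold E2
  have : ∑ w ∈ S, dg G S w ≤ ∑ w ∈ S, (dg (delE G u v) S w +
      (if w = u then 1 else 0) + (if w = v then 1 else 0)) := by
    apply sum_le_sum
    intro w hw
    have := dg_delE G S h w
    grind
  rw [sum_add_distrib, sum_add_distrib, sum_ite_eq', sum_ite_eq'] at this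
  split_ifs at this <;> omega

theorem sl_iter {m : ℕ} {A : Finset U} {x : U} (hx : x ∈ A) {d : U → ℕ}
    {c : ZMod (2 * m + 1) → U} (hdA : d x + 1 ≤ A.card) (k : ℕ) : ∀ G : SimpleGraph U,
    (∀ v ∈ A, v ≠ x → dg G A v = d v) → dg G A x + 2 * k = d x →
    SCyc m G (A.erase x) c → (∀ q ∈ A, q ≠ x → ¬ G.Adj x q → d x ≤ d q) →
    (k ≤ ((A.erase x \ univ.image c).filter fun q => ¬ G.Adj x q).card ∨
      ∃ s, G.Adj x (c s)) →
    ∃ G' : SimpleGraph U, Rz G' A d ∧ SCyc m G' (A.erase x) c ∧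
      E2 G (univ.image c) ≤ E2 G' (univ.image c) +
        2 * (k - ((A.erase x \ univ.image c).filter fun q => ¬ G.Adj x q).card) := by
  set S := univ.image c with hS
  induction k with
  | zero =>
    intro G h1 h2 h3 _ _
    refine ⟨G, ?_, h3, by omega⟩
    intro v hv
    by_cases h : v = x
    · subst h; omega
    · exact h1 v hv h
  | succ k ih =>
    intro G h1 h2 h3 h4 h5
    have hxS : x ∉ S := by
      intro h; rw [hS, mem_image] at h
      obtain ⟨i, _, hi⟩ := h
      have := h3.2.1 i
      rw [hi] at this; simp at this
    set Q := (A.erase x).filter fun q => ¬ G.Adj x q with hQ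
    set RQ := (A.erase x \ S).filter fun q => ¬ G.Adj x q with hRQ
    -- performing one subdivision
    have op : ∀ a b, a ∈ Q → b ∈ Q → G.Adj a b →
        (∀ i, ¬ ((c i = a ∧ c (i + 1) = b) ∨ (c i = b ∧ c (i + 1) = a))) →
        ∃ G1 : SimpleGraph U, (∀ v ∈ A, v ≠ x → dg G1 A v = d v) ∧ dg G1 A x + 2 * k = d x ∧
          SCyc m G1 (A.erase x) c ∧ (∀ q, G1.Adj x q ↔ G.Adj x q ∨ q = a ∨ q = b) ∧
          E2 G1 S = E2 (delE G a b) S := by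
      intro a b ha hb hab hnc
      rw [hQ, mem_filter, mem_erase] at ha hb
      obtain ⟨⟨hax, haA⟩, hna⟩ := ha
      obtain ⟨⟨hbx, hbA⟩, hnb⟩ := hb
      have hne := hab.ne
      have n1 : ¬ (delE G a b).Adj x a := fun h => hna h.1
      have n2 : ¬ (addE (delE G a b) x a).Adj x b := by
        rintro (h | ⟨_, h | h⟩)
        · exact hnb h.1
        · exact hne h.2.symm
        · exact hbx h.2
      have e1 : ∀ v, _ := fun v => dg_delE G A hab v
      have e2 : ∀ v, _ := fun v => dg_addE _ A hax.symm n1 v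
      have e3 : ∀ v, _ := fun v => dg_addE _ A hbx.symm n2 v
      simp only [haA, hbA, hx, and_true] at e1 e2 e3
      refine ⟨addE (addE (delE G a b) x a) x b, ?_, ?_, ?_, ?_, ?_⟩
      · intro v hv hvx
        have := e1 v; have := e2 v; have := e3 v; have := h1 v hv hvx
        grind
      · have := e1 x; have := e2 x; have := e3 x
        grind
      · refine ⟨h3.1, h3.2.1, fun i => Or.inl (Or.inl ⟨h3.2.2 i, ?_⟩)⟩
        have := hnc i
        tauto
      · intro q
        constructor
        · rintro ((h | ⟨_, h | h⟩) | ⟨_, h | h⟩)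
          · exact Or.inl h.1
          · exact Or.inr (Or.inl h.2)
          · exact absurd h.1.symm hax
          · exact Or.inr (Or.inr h.2)
          · exact absurd h.1.symm hbx
        · rintro (h | rfl | rfl)
          · left; left
            refine ⟨h, ?_⟩
            rintro (h' | h')
            · exact hax h'.1.symm
            · exact hbx h'.1.symm
          · left; right; exact ⟨hax.symm, Or.inl ⟨rfl, rfl⟩⟩
          · right; exact ⟨hbx.symm, Or.inl ⟨rfl, rfl⟩⟩
      · rw [E2_addE_not_mem _ _ hbx.symm n2 hxS, E2_addE_not_mem _ _ hax.symm n1 hxS]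
    -- neighbours in Q
    have nb : ∀ q ∈ Q, 2 * (k + 1) ≤ dg G Q q := by
      intro q hq
      rw [hQ, mem_filter, mem_erase] at hq
      obtain ⟨⟨hqx, hqA⟩, hnq⟩ := hq
      have hsub : A.filter (G.Adj q) ⊆ A.filter (G.Adj x) ∪ Q.filter (G.Adj q) := by
        intro y hy
        rw [mem_filter] at hy
        rw [mem_union, mem_filter, mem_filter, hQ, mem_filter, mem_erase]
        by_cases hxy : G.Adj x y
        · left; exact ⟨hy.1, hxy⟩
        · right; refine ⟨⟨⟨?_, hy.1⟩, hxy⟩, hy.2⟩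
          rintro rfl; exact hnq hy.2.symm
      have := (card_le_card hsub).trans (card_union_le _ _)
      change dg G A q ≤ dg G A x + dg G Q q at this
      have := h1 q hqA hqx
      have := h4 q hqA hqx hnq
      omega
    have hRQQ : RQ ⊆ Q := by
      intro y hy
      rw [hRQ, mem_filter, mem_sdiff] at hy
      exact mem_filter.2 ⟨hy.1.1, hy.2⟩
    have hRS : ∀ w ∈ RQ, w ∉ S := by
      intro w hw; rw [hRQ, mem_filter, mem_sdiff] at hw; exact hw.1.2
    have cS : ∀ i, c i ∈ S := fun i => mem_image_of_mem _ (mem_univ i)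
    by_cases hne : RQ.Nonempty
    · obtain ⟨w, hw⟩ := hne
      have hwQ := hRQQ hw
      have hwS := hRS w hw
      have hnb := nb w hwQ
      have hnc : ∀ b, ∀ i, ¬ ((c i = w ∧ c (i + 1) = b) ∨ (c i = b ∧ c (i + 1) = w)) := by
        rintro b i (h | h)
        · exact hwS (h.1 ▸ cS i)
        · exact hwS (h.2 ▸ cS _)
      by_cases hb : ∃ b ∈ Q, b ∈ S ∧ G.Adj w b
      · obtain ⟨b, hbQ, hbS, hwb⟩ := hb
        obtain ⟨G1, g1, g2, g3, g4, g5⟩ := op w b hwQ hbQ hwb (hnc b)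
        rw [dg_delE_not_mem G S hwb hwS] at g5
        have hcard : ((A.erase x \ S).filter fun q => ¬ G1.Adj x q) = RQ.erase w := by
          ext y
          rw [mem_filter, mem_erase, hRQ, mem_filter, g4, mem_sdiff]
          constructor
          · rintro ⟨h, h'⟩; push Not at h'; exact ⟨h'.2.1, h, h'.1⟩
          · rintro ⟨h, h', h''⟩
            refine ⟨h', ?_⟩
            push Not
            exact ⟨h'', h, fun hyb => h'.2 (hyb ▸ hbS)⟩
        have hpos := card_pos.2 ⟨w, hw⟩
        obtain ⟨G', k1, k2, k3⟩ := ih G1 g1 g2 g3 (fun q hq hqx hn => h4 q hq hqx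
          (fun h => hn ((g4 q).2 (Or.inl h)))) (by
          rw [hcard, card_erase_of_mem hw]
          rcases h5 with h5 | ⟨s, hs⟩
          · left; omega
          · right; exact ⟨s, (g4 _).2 (Or.inl hs)⟩)
        refine ⟨G', k1, k2, ?_⟩
        rw [hcard, card_erase_of_mem hw] at k3
        omega
      · push Not at hb
        have hsub : Q.filter (G.Adj w) ⊆ RQ.erase w := by
          intro y hy
          rw [mem_filter] at hy
          have hyS : y ∉ S := fun h => hb y hy.1 h hy.2
          rw [mem_erase, hRQ, mem_filter, mem_sdiff]
          have := hy.1
          rw [hQ, mem_filter] at this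
          exact ⟨hy.2.ne', ⟨this.1, hyS⟩, this.2⟩
        have hcl := card_le_card hsub
        change dg G Q w ≤ _ at hcl
        have hpos := card_pos.2 ⟨w, hw⟩
        rw [card_erase_of_mem hw] at hcl
        have : (Q.filter (G.Adj w)).Nonempty := by
          rw [← card_pos]; change 0 < dg G Q w; omega
        obtain ⟨b, hbm⟩ := this
        have hb' := mem_erase.1 (hsub hbm)
        rw [mem_filter] at hbm
        obtain ⟨G1, g1, g2, g3, g4, g5⟩ := op w b hwQ hbm.1 hbm.2 (hnc b)
        rw [dg_delE_not_mem G S hbm.2 hwS] at g5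
        have hcard : ((A.erase x \ S).filter fun q => ¬ G1.Adj x q) = (RQ.erase w).erase b := by
          ext y
          rw [mem_filter, mem_erase, mem_erase, hRQ, mem_filter, g4]
          tauto
        obtain ⟨G', k1, k2, k3⟩ := ih G1 g1 g2 g3 (fun q hq hqx hn => h4 q hq hqx
          (fun h => hn ((g4 q).2 (Or.inl h)))) (by
          rw [hcard, card_erase_of_mem (mem_erase.2 hb'), card_erase_of_mem hw]
          left; omega)
        refine ⟨G', k1, k2, ?_⟩
        rw [hcard, card_erase_of_mem (mem_erase.2 hb'), card_erase_of_mem hw] at k3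
        omega
    · rw [not_nonempty_iff_eq_empty] at hne
      rw [hne] at h5 ⊢
      rw [card_empty] at h5 ⊢
      have hs : ∃ s, G.Adj x (c s) := by
        rcases h5 with h5 | h5
        · omega
        · exact h5
      have hQS : ∀ q ∈ Q, q ∈ S := by
        intro q hq
        by_contra hqS
        have : q ∈ RQ := by
          rw [hQ, mem_filter] at hq
          rw [hRQ, mem_filter, mem_sdiff]; exact ⟨⟨hq.1, hqS⟩, hq.2⟩
        rw [hne] at this; simp at this
      have hQne : Q.Nonempty := by
        rw [← card_pos]
        have hf : ((A.erase x).filter (G.Adj x)).card + Q.card = (A.erase x).card :=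
          card_filter_add_card_filter_not (s := A.erase x) (p := G.Adj x)
        change dg G (A.erase x) x + Q.card = _ at hf
        rw [dg_self_erase G hx, card_erase_of_mem hx] at hf
        omega
      have hedge : ∃ a b, a ∈ Q ∧ b ∈ Q ∧ G.Adj a b ∧
          ∀ i, ¬ ((c i = a ∧ c (i + 1) = b) ∨ (c i = b ∧ c (i + 1) = a)) := by
        by_contra hcon
        push Not at hcon
        have hsucc : ∀ i, c i ∈ Q → c (i + 1) ∈ Q := by
          intro i hi
          by_contra hi1
          have hsub : Q.filter (G.Adj (c i)) ⊆ {c (i - 1)} := by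
            intro y hy
            rw [mem_filter] at hy
            obtain ⟨j, hj⟩ := hcon (c i) y hi hy.1 hy.2
            rcases hj with ⟨j1, j2⟩ | ⟨j1, j2⟩
            · have := h3.1 j1
              rw [this] at j2
              exact absurd (j2 ▸ hy.1) hi1
            · have := h3.1 j2
              rw [mem_singleton, ← j1]; congr 1; rw [← this]; ring
          have := card_le_card hsub
          rw [card_singleton] at this
          have h6 := nb _ hi
          change dg G Q (c i) ≤ 1 at this
          omega
        obtain ⟨q, hq⟩ := hQne
        have hqS := hQS q hq
        rw [hS, mem_image] at hqS
        obtain ⟨i, -, rfl⟩ := hqS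
        have hall : ∀ t : ℕ, c (i + (t : ZMod (2 * m + 1))) ∈ Q := by
          intro t
          induction t with
          | zero => simpa using hq
          | succ t iht =>
            have := hsucc _ iht
            push_cast; rw [← add_assoc]; exact this
        obtain ⟨s, hs⟩ := hs
        have h7 := hall (s - i).val
        rw [ZMod.natCast_zmod_val, add_sub_cancel, hQ, mem_filter] at h7
        exact h7.2 hs
      obtain ⟨a, b, ha, hb, hab, hnc⟩ := hedge
      obtain ⟨G1, g1, g2, g3, g4, g5⟩ := op a b ha hb hab hnc
      have hcard : ((A.erase x \ S).filter fun q => ¬ G1.Adj x q) = ∅ := by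
        rw [← subset_empty, ← hne]
        intro y hy
        rw [mem_filter, g4] at hy
        rw [hRQ, mem_filter]
        exact ⟨hy.1, fun h => hy.2 (Or.inl h)⟩
      obtain ⟨G', k1, k2, k3⟩ := ih G1 g1 g2 g3 (fun q hq hqx hn => h4 q hq hqx
          (fun h => hn ((g4 q).2 (Or.inl h)))) (by
          right
          obtain ⟨s, hs⟩ := hs
          exact ⟨s, (g4 _).2 (Or.inl hs)⟩)
      refine ⟨G', k1, k2, ?_⟩
      rw [hcard, card_empty] at k3
      have := E2_delE G S hab
      omega

theorem step_lemma {m : ℕ} {A T : Finset U} {x : U} (hx : x ∈ A) (hT : T ⊆ A.erase x)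
    {d d' : U → ℕ} {c : ZMod (2 * m + 1) → U} {G' : SimpleGraph U} (hG' : Rz G' (A.erase x) d')
    (hd : ∀ v ∈ A.erase x, d v = d' v + if v ∈ T then 1 else 0) (j : ℕ)
    (hdx : d x = T.card + 2 * j) (hdA : d x + 1 ≤ A.card) (hc : SCyc m G' (A.erase x) c)
    (hq : ∀ q ∈ A.erase x, q ∉ T → d x ≤ d q)
    (hor : j ≤ ((A.erase x \ univ.image c) \ T).card ∨ ∃ s, c s ∈ T) :
    ∃ G : SimpleGraph U, Rz G A d ∧ SCyc m G A c ∧ E2 G' (univ.image c) ≤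
      E2 G (univ.image c) + 2 * (j - ((A.erase x \ univ.image c) \ T).card) := by
  set G0 := addV G' x T with hG0
  have hxT : x ∉ T := fun h => by simpa using hT h
  have cx : ∀ i, c i ≠ x := fun i => (mem_erase.1 (hc.2.1 i)).1
  have hr : Rz G0 A (Function.update d x T.card) := by
    refine rz_addV hx hT hG' ?_ (by simp)
    intro v hv
    rw [Function.update_of_ne (mem_erase.1 hv).1]; exact hd v hv
  have hadj : ∀ q, G0.Adj x q ↔ q ∈ T := by
    intro q
    simp only [hG0, addV]
    constructor
    · rintro (h | h | h)
      · exact absurd rfl h.2.1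
      · exact h.2.1
      · exact absurd rfl h.2.2
    · intro h
      exact Or.inr (Or.inl ⟨trivial, h, fun h' => hxT (h' ▸ h)⟩)
  have hRQ : ((A.erase x \ univ.image c).filter fun q => ¬ G0.Adj x q) =
      (A.erase x \ univ.image c) \ T := by
    ext y; rw [mem_filter, hadj]; simp only [mem_sdiff]
  have hE : E2 G0 (univ.image c) = E2 G' (univ.image c) := by
    unfold E2
    apply sum_congr rfl
    intro v hv
    apply dg_congr
    intro w hw
    rw [mem_image] at hv hw
    obtain ⟨i, -, rfl⟩ := hv
    obtain ⟨i', -, rfl⟩ := hw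
    have := cx i; have := cx i'
    simp only [hG0, addV]; tauto
  obtain ⟨G, g1, g2, g3⟩ := sl_iter (m := m) hx (d := d) (c := c) hdA j G0
    (fun v hv hvx => by have := hr v hv; rwa [Function.update_of_ne hvx] at this)
    (by have := hr x hx; rw [Function.update_self] at this; omega)
    ⟨hc.1, hc.2.1, fun i => Or.inl ⟨hc.2.2 i, cx _, cx _⟩⟩
    (fun q hqA hqx hn => hq q (mem_erase.2 ⟨hqx, hqA⟩) (fun h => hn ((hadj q).2 h)))
    (by rw [hRQ]; simpa only [hadj] using hor)
  rw [hRQ, hE] at g3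
  exact ⟨G, g1, ⟨g2.1, fun i => mem_of_mem_erase (g2.2.1 i), g2.2.2⟩, g3⟩

end SL

section Chain
open Classical Finset

variable {U : Type*}

theorem sum_lower {L W : Finset U} (hW : W ⊆ L) (d : U → ℕ) (p q : ℕ) (h1 : ∀ w ∈ W, p ≤ d w)
    (h2 : ∀ w ∈ L, q ≤ d w) : W.card * p + (L.card - W.card) * q ≤ ∑ v ∈ L, d v := by
  rw [← sum_sdiff hW, add_comm, ← card_sdiff_of_subset hW]
  apply add_le_add
  · rw [← smul_eq_mul]; exact card_nsmul_le_sum _ _ _ fun v hv => h2 v (mem_sdiff.1 hv).1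
  · rw [← smul_eq_mul]; exact card_nsmul_le_sum _ _ _ h1

theorem sum_upper {L W : Finset U} (hW : W ⊆ L) (d : U → ℕ) (p q : ℕ) (h1 : ∀ w ∈ W, d w ≤ p)
    (h2 : ∀ w ∈ L, w ∉ W → d w ≤ q) : ∑ v ∈ L, d v ≤ W.card * p + (L.card - W.card) * q := by
  rw [← sum_sdiff hW, add_comm, ← card_sdiff_of_subset hW]
  apply add_le_add
  · rw [← smul_eq_mul]; exact sum_le_card_nsmul _ _ _ h1
  · rw [← smul_eq_mul]
    exact sum_le_card_nsmul _ _ _ fun v hv => h2 v (mem_sdiff.1 hv).1 (mem_sdiff.1 hv).2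

/-- The alternative maintained along the chain. -/
def Alt (m s : ℕ) (L : Finset U) (d : U → ℕ) (x : U) : Prop :=
  s + 2 + 2 * m ≤ 2 * d x ∨ (L.filter fun v => d x + 2 ≤ d v).card + d x + 2 ≤ 2 * m

theorem alt_step {m s : ℕ} {L T : Finset U} {d d' : U → ℕ} {x y : U}
    (hxmin : ∀ v ∈ L, d x ≤ d v) (hT : T ⊆ L.erase x)
    (htop : ∀ t ∈ T, ∀ u ∈ L.erase x \ T, d u ≤ d t)
    (hd : ∀ v ∈ L.erase x, d v = d' v + if v ∈ T then 1 else 0)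
    (hc1 : T.card + d x ≤ 2 * m) (hc2 : 2 * m ≤ T.card + d x + 1) (hy : y ∈ L.erase x)
    (hymin : ∀ v ∈ L.erase x, d' y ≤ d' v) (halt : Alt m s L d x) : Alt m s (L.erase x) d' y := by
  by_cases hA : ∃ t ∈ T, d t = d x
  · obtain ⟨t, ht, htx⟩ := hA
    right
    have h1 := hd t (hT ht)
    rw [if_pos ht] at h1
    have h2 := hymin t (hT ht)
    have hsub : ((L.erase x).filter fun v => d' y + 2 ≤ d' v) ⊆ T.erase t := by
      intro v hv
      rw [mem_filter] at hv
      have h3 := hd v hv.1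
      have h4 := hxmin y (mem_of_mem_erase hy)
      have h5 := hd y hy
      have h6 : d x ≤ d' y + 1 := by split_ifs at h5 <;> omega
      by_cases hvT : v ∈ T
      · refine mem_erase.2 ⟨?_, hvT⟩
        rintro rfl
        omega
      · exfalso
        have := htop t ht v (mem_sdiff.2 ⟨hv.1, hvT⟩)
        rw [if_neg hvT] at h3
        omega
    have := card_le_card hsub
    rw [card_erase_of_mem ht] at this
    have := card_pos.2 ⟨t, ht⟩
    omega
  · push Not at hA
    have hge : ∀ v ∈ L.erase x, d x ≤ d' v := by
      intro v hv
      have h1 := hd v hv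
      have h2 := hxmin v (mem_of_mem_erase hv)
      by_cases hvT : v ∈ T
      · have := hA v hvT
        rw [if_pos hvT] at h1; omega
      · rw [if_neg hvT] at h1; omega
    have hy' := hge y hy
    rcases halt with h | h
    · left; omega
    · right
      have : ∃ t ∈ T, ¬ (d x + 2 ≤ d t) := by
        by_contra hcon
        push Not at hcon
        have : T ⊆ L.filter fun v => d x + 2 ≤ d v := fun t ht =>
          mem_filter.2 ⟨mem_of_mem_erase (hT ht), hcon t ht⟩
        have := card_le_card this
        omega
      obtain ⟨t, ht, ht2⟩ := this
      have h1 := hd t (hT ht)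
      rw [if_pos ht] at h1
      have h2 := hymin t (hT ht)
      have hyx : d' y = d x := by omega
      rw [hyx]
      have hsub : ((L.erase x).filter fun v => d x + 2 ≤ d' v) ⊆ L.filter fun v => d x + 2 ≤ d v := by
        intro v hv
        rw [mem_filter] at hv ⊢
        have := hd v hv.1
        exact ⟨mem_of_mem_erase hv.1, by omega⟩
      have := card_le_card hsub
      omega

/-- Hypotheses for the chain with a special vertex `z`. -/
structure HB (m r s : ℕ) (A : Finset U) (d : U → ℕ) (z x : U) : Prop where
  hm : 2 ≤ m
  card : A.card = 2 * m + 1 + r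
  hz : z ∈ A
  hx : x ∈ A.erase z
  xmin : ∀ v ∈ A.erase z, d x ≤ d v
  low : m + 1 ≤ d x
  up : ∀ v ∈ A, d v ≤ 2 * m + r
  bal : ∀ v ∈ A.erase z, d v + r ≤ d z + m
  sum : ∑ v ∈ A, d v = 3 * m ^ 2 + m + 2 * m * r + 2 + s
  hs : s + 4 ≤ 2 * m
  even : Even s
  alt : Alt m s (A.erase z) d x

theorem HB.cardO {m r s : ℕ} {A : Finset U} {d : U → ℕ} {z x : U} (h : HB m r s A d z x) :
    (A.erase z).card = 2 * m + r := by
  rw [card_erase_of_mem h.hz, h.card]; omega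

theorem HB.sumO {m r s : ℕ} {A : Finset U} {d : U → ℕ} {z x : U} (h : HB m r s A d z x) :
    d z + ∑ v ∈ A.erase z, d v = 3 * m ^ 2 + m + 2 * m * r + 2 + s := by
  rw [add_sum_erase A _ h.hz, h.sum]

theorem HB.n1 {m r s : ℕ} {A : Finset U} {d : U → ℕ} {z x : U} (h : HB m r s A d z x) :
    d x + 1 ≤ 2 * m := by
  by_contra hcon
  have h1 := sum_lower (empty_subset (A.erase z)) d 0 (2 * m) (by simp) (fun w hw => by
    have := h.xmin w hw; omega)
  rw [card_empty, h.cardO] at h1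
  have h2 := h.sumO
  have h3 := h.bal x h.hx
  have h4 := h.hs
  have h5 := h.hm
  simp only [zero_mul, Nat.sub_zero, zero_add] at h1
  nlinarith

/-- the balance: `d z ≥ 2` -/
theorem HB.D2 {m s : ℕ} {A : Finset U} {d : U → ℕ} {z x : U} (h : HB m 0 s A d z x) :
    2 ≤ d z := by
  by_contra hcon
  have h1 := sum_upper (empty_subset (A.erase z)) d 0 (m + 1) (by simp) (fun w hw _ => by
    have := h.bal w hw; omega)
  rw [card_empty, h.cardO] at h1
  have h2 := h.sumO
  have h5 := h.hm
  simp only [zero_mul, Nat.sub_zero, zero_add, add_zero, mul_zero] at h1 h2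
  nlinarith

theorem HB.evenσ {m r s : ℕ} {A : Finset U} {d : U → ℕ} {z x : U} (h : HB m r s A d z x) :
    Even (∑ v ∈ A, d v) := by
  rw [h.sum]
  have h1 := h.even
  have h2 : Even (3 * m ^ 2 + m) := by
    rcases Nat.even_or_odd m with hm | hm
    · exact ((hm.pow_of_ne_zero (by norm_num)).mul_left 3).add hm
    · exact ((by decide : Odd 3).mul hm.pow).add_odd hm
  have h3 : Even (2 * m * r) := by rw [mul_assoc]; exact even_two_mul _
  exact ((h2.add h3).add even_two).add h1

theorem base_num1 {m s j D p : ℕ} (hs : s + 4 ≤ 2 * m) (hj : 1 ≤ j) (hjm : j + 1 ≤ m)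
    (hD : m ≤ D) (hp : m + 1 ≤ p) :
    3 * m ^ 2 + m + 2 + s + p + p * (m + j) ≤ 2 * D + 2 * m * (m + j) + 2 * m * p  := by
  obtain ⟨e, rfl⟩ : ∃ e, m = j + 1 + e := ⟨m - (j + 1), by omega⟩
  obtain ⟨f, rfl⟩ : ∃ f, p = j + 1 + e + 1 + f := ⟨p - (j + 1 + e + 1), by omega⟩
  obtain ⟨g, rfl⟩ : ∃ g, j = g + 1 := ⟨j - 1, by omega⟩
  nlinarith [Nat.zero_le (f * e), Nat.zero_le (g * e), Nat.zero_le (f * g)]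

theorem base_num2 {m s j D p b : ℕ} (hs : s + 4 ≤ 2 * m) (hj : 1 ≤ j) (hjm : j + 1 ≤ m)
    (hp : m + j + 1 ≤ p) (hp2 : p + b = 2 * m + 1) (hD : m + j ≤ D ∨ (2 ≤ D ∧ (j = 1 → s = 0))) :
    3 * m ^ 2 + m + 2 + s ≤ p * (p - 1) + 2 * (m + j) * b ∧
    (D < m + j → 3 * m ^ 2 + m + 2 + s + 2 * (m + j) ≤ p * (p - 1) + 2 * (m + j) * b + 2 * D) := by
  obtain ⟨f, rfl⟩ : ∃ f, p = m + j + 1 + f := ⟨p - (m + j + 1), by omega⟩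
  have e1 : m + j + 1 + f - 1 = m + j + f := by omega
  rw [e1]
  have hb : (b : ℤ) = m - j - f := by omega
  have key : (m + j + 1 + f : ℤ) * (m + j + f) + 2 * (m + j) * b =
      3 * m ^ 2 + m + j * (2 * m + 1 - j) + f + f ^ 2 := by rw [hb]; ring
  have hf : (0 : ℤ) ≤ f := Int.natCast_nonneg f
  have hj' : (1 : ℤ) ≤ j := by exact_mod_cast hj
  have hjm' : (j : ℤ) + 1 ≤ m := by exact_mod_cast hjm
  have hs' : (s : ℤ) + 4 ≤ 2 * m := by exact_mod_cast hs
  zify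
  constructor
  · rw [key]
    nlinarith [mul_nonneg (sub_nonneg.2 hj') (by linarith : (0 : ℤ) ≤ 2 * m - j)]
  · intro hlt
    obtain ⟨hD2, hjs⟩ := hD.resolve_left (by omega)
    have hD2' : (2 : ℤ) ≤ D := by exact_mod_cast hD2
    rw [key]
    by_cases h1 : j = 1
    · have := hjs h1
      subst this; subst h1
      push_cast
      nlinarith
    · have hj2 : (2 : ℤ) ≤ j := by omega
      nlinarith [mul_nonneg (sub_nonneg.2 hj2) (by linarith : (0 : ℤ) ≤ 2 * m - 3 - j)]

theorem HB.js {m s : ℕ} {A : Finset U} {d : U → ℕ} {z x : U} (h : HB m 0 s A d z x)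
    (hj : d x = m + 1) (hD : d z < m + 1) : s = 0 := by
  rcases h.alt with h1 | h1
  · omega
  · by_contra hs0
    have hs2 : 2 ≤ s := by
      obtain ⟨t, ht⟩ := h.even
      omega
    rw [hj] at h1
    set W := (A.erase z).filter fun v => m + 1 + 2 ≤ d v with hW
    have h3 := sum_upper (W := W) (L := A.erase z) (filter_subset _ _) d (d z + m) (m + 2) (by
      intro w hw
      have := h.bal w (mem_filter.1 hw).1; omega) (by
      intro w hw hwn
      by_contra hcon
      exact hwn (mem_filter.2 ⟨hw, by omega⟩))
    have h2 := h.sumO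
    have h4 := h.D2
    rw [h.cardO] at h3
    have hm := h.hm
    obtain ⟨e, he⟩ : ∃ e, m = W.card + 3 + e := ⟨m - (W.card + 3), by omega⟩
    have h5 : 2 * m + 0 - W.card = m + 3 + e := by omega
    rw [h5] at h3
    generalize W.card = k at *
    subst he
    nlinarith

theorem HB.eg_base [Fintype U] {m s : ℕ} {A : Finset U} {d : U → ℕ} {z x : U}
    (h : HB m 0 s A d z x) : ∃ G : SimpleGraph U, Rz G A d := by
  apply eg h.evenσ
  intro P hP hPne
  have hPc := card_pos.2 hPne
  have hPle := card_le_card hP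
  rw [h.card] at hPle
  obtain ⟨j, hj⟩ : ∃ j, d x = m + j := ⟨d x - m, by have := h.low; omega⟩
  have hj1 : 1 ≤ j := by have := h.low; omega
  have hjm : j + 1 ≤ m := by have := h.n1; omega
  have hD2 := h.D2
  have hm := h.hm
  have hs := h.hs
  have hsumO := h.sumO
  have hcO := h.cardO
  have hcAP : (A \ P).card = 2 * m + 1 - P.card := by rw [card_sdiff_of_subset hP, h.card]
  set p := P.card with hp
  simp only [add_zero, mul_zero] at hsumO hcO hPle hcAP
  -- minimum over outside vertices
  by_cases hpd : p ≤ d x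
  · by_cases hzp : z ∈ P ∨ p ≤ d z
    · have h1 : ∑ v ∈ P, d v ≤ p * (2 * m) := by
        rw [← smul_eq_mul]; apply sum_le_card_nsmul
        intro v hv; have := h.up v (hP hv); omega
      have h2 : (A \ P).card * p ≤ ∑ v ∈ A \ P, min p (d v) := by
        rw [← smul_eq_mul]; apply card_nsmul_le_sum
        intro v hv
        rw [mem_sdiff] at hv
        apply le_min le_rfl
        by_cases hvz : v = z
        · subst hvz
          rcases hzp with h' | h'
          · exact absurd h' hv.2
          · exact h'
        · exact hpd.trans (h.xmin v (mem_erase.2 ⟨hvz, hv.1⟩))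
      rw [hcAP] at h2
      have h3 : p * (2 * m) = p * (p - 1) + (2 * m + 1 - p) * p := by
        have : 2 * m = (p - 1) + (2 * m + 1 - p) := by omega
        conv_lhs => rw [this, mul_add]
        ring
      omega
    · push Not at hzp
      obtain ⟨hzP, hzp⟩ := hzp
      have hPO : P ⊆ A.erase z := fun v hv => mem_erase.2 ⟨fun h' => hzP (h' ▸ hv), hP hv⟩
      have hzAP : z ∈ A \ P := mem_sdiff.2 ⟨h.hz, hzP⟩
      have h2 : d z + ((A \ P).erase z).card * p ≤ ∑ v ∈ A \ P, min p (d v) := by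
        rw [← add_sum_erase _ _ hzAP]
        apply add_le_add
        · exact le_min hzp.le le_rfl
        · rw [← smul_eq_mul]; apply card_nsmul_le_sum
          intro v hv
          rw [mem_erase, mem_sdiff] at hv
          exact le_min le_rfl (hpd.trans (h.xmin v (mem_erase.2 ⟨hv.1, hv.2.1⟩)))
      rw [card_erase_of_mem hzAP, hcAP] at h2
      have hp2 : p ≤ 2 * m := by rw [← hcO]; exact card_le_card hPO
      have h3 : p * (2 * m) = p * (p - 1) + (2 * m + 1 - p - 1) * p + p := by
        have : 2 * m = (p - 1) + (2 * m + 1 - p - 1) + 1 := by omega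
        conv_lhs => rw [this, mul_add, mul_add]
        ring
      by_cases hDm : d z + 1 ≤ m
      · have h1 : ∑ v ∈ P, d v ≤ p * (2 * m - 1) := by
          rw [← smul_eq_mul]; apply sum_le_card_nsmul
          intro v hv; have := h.bal v (hPO hv); omega
        have h4 : p * (2 * m - 1) + p = p * (2 * m) := by
          obtain ⟨e, rfl⟩ : ∃ e, m = e + 1 := ⟨m - 1, by omega⟩
          have : 2 * (e + 1) - 1 = 2 * e + 1 := by omega
          rw [this]; ring
        omega
      · have h5 := sum_sdiff hPO (f := d)
        have h6 : (2 * m - p) * d x ≤ ∑ v ∈ A.erase z \ P, d v := by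
          have : (A.erase z \ P).card = 2 * m - p := by rw [card_sdiff_of_subset hPO, hcO]
          rw [← this, ← smul_eq_mul]; apply card_nsmul_le_sum
          intro v hv; exact h.xmin v (mem_sdiff.1 hv).1
        have h7 := base_num1 (m := m) (s := s) (j := j) (D := d z) (p := p) hs hj1 hjm (by omega) (by omega)
        have h8 : (2 * m - p) * d x + p * (m + j) = 2 * m * (m + j) := by
          rw [hj, ← add_mul]; congr 1; omega
        have h9 : p * (2 * m) = 2 * m * p := by ring
        omega
  · have h5 := sum_sdiff hP (f := d)
    have h10 := h.sum
    simp only [mul_zero, add_zero] at h10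
    have h11 := base_num2 (m := m) (s := s) (j := j) (D := d z) (p := p) (b := (A \ P).card) hs hj1 hjm
      (by omega) (by omega) (by
        by_cases hh : m + j ≤ d z
        · exact Or.inl hh
        · refine Or.inr ⟨hD2, fun hj1 => h.js (by omega) (by omega)⟩)
    suffices hmain : 3 * m ^ 2 + m + 2 + s ≤ p * (p - 1) + ∑ v ∈ A \ P, (d v + min p (d v)) by
      rw [sum_add_distrib] at hmain
      omega
    have hout : ∀ v ∈ A \ P, v ≠ z → 2 * (m + j) ≤ d v + min p (d v) := by
      intro v hv hvz
      rw [mem_sdiff] at hv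
      have h1 := h.xmin v (mem_erase.2 ⟨hvz, hv.1⟩)
      have : d x ≤ min p (d v) := le_min (by omega) h1
      omega
    by_cases hzz : z ∈ A \ P ∧ d z < m + j
    · obtain ⟨hzAP, hzlt⟩ := hzz
      have h2 : 2 * d z + ((A \ P).erase z).card * (2 * (m + j)) ≤ ∑ v ∈ A \ P, (d v + min p (d v)) := by
        rw [← add_sum_erase _ _ hzAP]
        apply add_le_add
        · have : d z ≤ min p (d z) := le_min (by omega) le_rfl
          omega
        · rw [← smul_eq_mul]; apply card_nsmul_le_sum
          intro v hv
          rw [mem_erase] at hv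
          exact hout v hv.2 hv.1
      have h12 := h11.2 hzlt
      rw [card_erase_of_mem hzAP] at h2
      have hpos := card_pos.2 ⟨z, hzAP⟩
      generalize (A \ P).card = b at *
      obtain ⟨b, rfl⟩ : ∃ b', b = b' + 1 := ⟨b - 1, by omega⟩
      rw [Nat.add_sub_cancel] at h2
      nlinarith
    · have h2 : (A \ P).card * (2 * (m + j)) ≤ ∑ v ∈ A \ P, (d v + min p (d v)) := by
        rw [← smul_eq_mul]; apply card_nsmul_le_sum
        intro v hv
        by_cases hvz : v = z
        · subst hvz
          have : ¬ d v < m + j := fun h' => hzz ⟨hv, h'⟩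
          have : m + j ≤ min p (d v) := le_min (by omega) (by omega)
          omega
        · exact hout v hv hvz
      have h12 := h11.1
      nlinarith

end Chain

section LemB
open Classical Finset

variable {U : Type*}

/-- Subtract the indicator of `T`. -/
noncomputable def lay (d : U → ℕ) (T : Finset U) (v : U) : ℕ := d v - if v ∈ T then 1 else 0

theorem lay_eq {d : U → ℕ} {T : Finset U} (h : ∀ t ∈ T, 1 ≤ d t) (v : U) :
    d v = lay d T v + if v ∈ T then 1 else 0 := by
  unfold lay
  split_ifs with hv
  · have := h v hv; omega
  · omega

theorem lay_sum {d : U → ℕ} {L T : Finset U} (hT : T ⊆ L) (h : ∀ t ∈ T, 1 ≤ d t) :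
    ∑ v ∈ L, lay d T v + T.card = ∑ v ∈ L, d v := by
  rw [sum_congr rfl fun v _ => lay_eq h v, sum_add_distrib]
  congr 1
  rw [← sum_filter, filter_mem_eq_inter, inter_eq_right.2 hT]
  simp

theorem HB.base [Fintype U] {m s : ℕ} {A : Finset U} {d : U → ℕ} {z x : U}
    (h : HB m 0 s A d z x) : ∃ (G : SimpleGraph U) (c : ZMod (2 * m + 1) → U), Rz G A d ∧
      SCyc m G A c ∧ (∃ i, c i = z) ∧ 3 * m ^ 2 + m + 2 ≤ E2 G (univ.image c) := by
  obtain ⟨G, hG⟩ := h.eg_base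
  have hm := h.hm
  have hcard := h.card
  obtain ⟨c, hc⟩ := posa (m := m) (by omega) (A := A) (by omega) G (by
    intro i hi him
    have hsub : (A.filter fun v => dg G A v ≤ i) ⊆ {z} := by
      intro v hv
      rw [mem_filter] at hv
      by_contra hvz
      have h1 := h.xmin v (mem_erase.2 ⟨by simpa using hvz, hv.1⟩)
      have h2 := h.low
      rw [hG v hv.1] at hv
      omega
    by_cases hi1 : i = 1
    · subst hi1
      rw [Nat.lt_one_iff, card_eq_zero, filter_eq_empty_iff]
      intro v hv hle
      have := hsub (mem_filter.2 ⟨hv, hle⟩)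
      rw [mem_singleton] at this
      subst this
      rw [hG v hv] at hle
      have := h.D2
      omega
    · have := card_le_card hsub
      rw [card_singleton] at this
      omega)
  have hsub : univ.image c ⊆ A := by
    intro v hv
    obtain ⟨i, -, rfl⟩ := mem_image.1 hv
    exact hc.2.1 i
  have himg : univ.image c = A := by
    apply eq_of_subset_of_card_le hsub
    rw [card_image_of_injective _ hc.1, card_univ, ZMod.card, hcard]
  refine ⟨G, c, hG, hc, ?_, ?_⟩
  · have := h.hz
    rw [← himg] at this
    obtain ⟨i, -, hi⟩ := mem_image.1 this
    exact ⟨i, hi⟩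
  · rw [himg]
    unfold E2
    rw [sum_congr rfl hG, h.sum]
    omega

theorem num3 {m j r s D σ : ℕ} (hj : j ≤ m) (h : (m - j) * (2 * m + r) + (m + j + r) * (m + j) + D ≤ σ)
    (hσ : σ = 3 * m ^ 2 + m + 2 * m * r + 2 + s) : D + j ^ 2 ≤ m + 2 + s := by
  obtain ⟨k, rfl⟩ : ∃ k, m = j + k := ⟨m - j, by omega⟩
  rw [Nat.add_sub_cancel_left] at h
  subst hσ
  nlinarith

theorem two_sq (j : ℕ) : 2 * j ≤ j ^ 2 + 1 := by
  zify; nlinarith [sq_nonneg ((j : ℤ) - 1)]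

set_option maxHeartbeats 1000000 in
theorem lemB [Fintype U] (m s : ℕ) : ∀ r, r ≤ m → ∀ (A : Finset U) (d : U → ℕ) (z x : U),
    HB m r s A d z x → ∃ (G : SimpleGraph U) (c : ZMod (2 * m + 1) → U), Rz G A d ∧
      SCyc m G A c ∧ (∃ i, c i = z) ∧ 3 * m ^ 2 + m + 2 + r + r ^ 2 ≤ E2 G (univ.image c) + 2 * m * r := by
  intro r
  induction r with
  | zero =>
    intro _ A d z x h
    obtain ⟨G, c, h1, h2, h3, h4⟩ := h.base
    exact ⟨G, c, h1, h2, h3, by omega⟩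
  | succ r ih =>
    intro hrm A d z x h
    have hm := h.hm
    have hlow := h.low
    have hn1 := h.n1
    have hcard := h.card
    have hxA : x ∈ A := mem_of_mem_erase h.hx
    have hxz : x ≠ z := ne_of_mem_erase h.hx
    have hcardO := h.cardO
    have hcardL : ((A.erase z).erase x).card = 2 * m + r := by
      rw [card_erase_of_mem h.hx, hcardO]; omega
    obtain ⟨j, hj⟩ : ∃ j, d x = m + j := ⟨d x - m, by omega⟩
    obtain ⟨T0, hT0, hc0, htop⟩ := exists_top ((A.erase z).erase x) d (m - j - 1) (by omega)
    have hzT0 : z ∉ T0 := fun hh => by simpa using hT0 hh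
    set T := insert z T0 with hTdef
    have hTc : T.card = m - j := by rw [card_insert_of_notMem hzT0, hc0]; omega
    have hTsub : T ⊆ A.erase x := by
      intro t ht
      rcases mem_insert.1 ht with rfl | ht
      · exact mem_erase.2 ⟨hxz.symm, h.hz⟩
      · have := hT0 ht
        simp only [mem_erase] at this ⊢
        tauto
    have hdz : r + 2 ≤ d z := by have := h.bal x h.hx; omega
    have hpos : ∀ t ∈ T, 1 ≤ d t := by
      intro t ht
      rcases mem_insert.1 ht with rfl | ht
      · omega
      · have := h.xmin t (mem_of_mem_erase (hT0 ht)); omega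
    set d' := lay d T with hd'
    have hd : ∀ v, d v = d' v + if v ∈ T then 1 else 0 := lay_eq hpos
    have hsum' : ∑ v ∈ A.erase x, d' v + T.card = ∑ v ∈ A.erase x, d v := lay_sum hTsub hpos
    have hsum := h.sum
    rw [← add_sum_erase A _ hxA] at hsum
    have hcomm : (A.erase z).erase x = (A.erase x).erase z := erase_right_comm
    have hne : ((A.erase x).erase z).Nonempty := by
      rw [← hcomm, ← card_pos]; omega
    obtain ⟨y, hy, hymin⟩ := exists_min_image _ d' hne
    have hdO : ∀ v ∈ (A.erase z).erase x, d v = d' v + if v ∈ T0 then 1 else 0 := by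
      intro v hv
      rw [hd v]
      have hvz : v ≠ z := by simp only [mem_erase] at hv; tauto
      simp [hTdef, hvz]
    -- no vertex of degree m + 1 in T0
    have n4 : ∀ t ∈ T0, m + 2 ≤ d t := by
      intro t ht
      by_contra hcon
      have hxt := h.xmin t (mem_of_mem_erase (hT0 ht))
      have hj1 : j = 1 := by omega
      have h0 : 0 < T0.card := card_pos.2 ⟨t, ht⟩
      have hWc : (T0.erase t).card = m - 3 := by rw [card_erase_of_mem ht]; omega
      have h1 := sum_upper (W := T0.erase t) (L := A.erase z)
        (fun v hv => mem_of_mem_erase (hT0 (mem_of_mem_erase hv))) d (2 * m + (r + 1)) (m + 1)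
        (fun w hw => h.up w (mem_of_mem_erase (mem_of_mem_erase (hT0 (mem_of_mem_erase hw)))))
        (by
          intro w hw hwW
          by_cases hwx : w = x
          · subst hwx; omega
          by_cases hwt : w = t
          · subst hwt; omega
          have : w ∉ T0 := fun h' => hwW (mem_erase.2 ⟨hwt, h'⟩)
          have := htop t ht w (mem_sdiff.2 ⟨mem_erase.2 ⟨hwx, hw⟩, this⟩)
          omega)
      have h2 := h.sumO
      have h3 := h.up z h.hz
      rw [hWc, hcardO] at h1
      obtain ⟨e, rfl⟩ : ∃ e, m = e + 3 := ⟨m - 3, by omega⟩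
      have e1 : 2 * (e + 3) + (r + 1) - (e + 3 - 3) = e + r + 7 := by omega
      rw [e1, Nat.add_sub_cancel] at h1
      nlinarith
    have n3 : ∀ v ∈ (A.erase z).erase x, v ∉ T0 → d v ≤ 2 * m + r := by
      intro v hv hvT
      by_contra hcon
      have hWc : (insert v T0).card = m - j := by
        rw [card_insert_of_notMem hvT, hc0]; omega
      have hWsub : insert v T0 ⊆ A.erase z := by
        intro w hw
        rcases mem_insert.1 hw with rfl | hw
        · exact mem_of_mem_erase hv
        · exact mem_of_mem_erase (hT0 hw)
      have hWd : ∀ w ∈ insert v T0, 2 * m + (r + 1) ≤ d w := by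
        intro w hw
        rcases mem_insert.1 hw with rfl | hw
        · omega
        · have := htop w hw v (mem_sdiff.2 ⟨hv, hvT⟩); omega
      rcases h.alt with h1 | h1
      · have h2 := sum_lower hWsub d _ (d x) hWd h.xmin
        have h3 := h.sumO
        rw [hWc, hcardO, hj] at h2
        have e1 : 2 * m + (r + 1) - (m - j) = m + j + (r + 1) := by omega
        rw [e1] at h2
        have h4 := num3 (m := m) (j := j) (r := r + 1) (s := s) (D := d z) (by omega)
          (by rw [add_comm]; exact Nat.add_le_add_left h2 _) h3
        have h5 := h.bal v (mem_of_mem_erase hv)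
        have h6 := two_sq j
        omega
      · have : insert v T0 ⊆ (A.erase z).filter fun v => d x + 2 ≤ d v := by
          intro w hw
          have := hWd w hw
          exact mem_filter.2 ⟨hWsub hw, by omega⟩
        have := card_le_card this
        omega
    have hd'z : d' z + 1 = d z := by
      have := hd z
      rw [if_pos (mem_insert_self _ _)] at this; omega
    have HB' : HB m r s (A.erase x) d' z y := by
      refine ⟨hm, ?_, mem_erase.2 ⟨hxz.symm, h.hz⟩, hy, hymin, ?_, ?_, ?_, ?_, h.hs, h.even, ?_⟩
      · rw [card_erase_of_mem hxA]; omega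
      · rw [← hcomm] at hy
        have h1 := hdO y hy
        have h2 := h.xmin y (mem_of_mem_erase hy)
        split_ifs at h1 with h3
        · have := n4 y h3; omega
        · omega
      · intro v hv
        by_cases hvz : v = z
        · subst hvz
          have := h.up v h.hz
          omega
        · have hv' : v ∈ (A.erase z).erase x := by
            rw [hcomm]; exact mem_erase.2 ⟨hvz, hv⟩
          have h1 := hdO v hv'
          split_ifs at h1 with h3
          · have := h.up v (mem_of_mem_erase hv); omega
          · have := n3 v hv' h3; omega
      · intro v hv
        rw [← hcomm] at hv
        have h1 := hd v
        have h2 := h.bal v (mem_of_mem_erase hv)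
        omega
      · rw [hTc] at hsum'
        have : 2 * m * (r + 1) = 2 * m * r + 2 * m := by ring
        omega
      · rw [← hcomm] at hy hymin ⊢
        exact alt_step h.xmin hT0 htop hdO (by omega) (by omega) hy hymin h.alt
    obtain ⟨G', c, hG', hc, ⟨i, hi⟩, hE⟩ := ih (by omega) _ _ _ _ HB'
    obtain ⟨G, hG, hcG, hEG⟩ := step_lemma hxA hTsub hG' (fun v _ => hd v) j (by omega)
      (by omega) hc (by
        intro q hq hqT
        apply h.xmin q
        refine mem_erase.2 ⟨?_, mem_of_mem_erase hq⟩
        rintro rfl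
        exact hqT (mem_insert_self _ _)) (Or.inr ⟨i, by rw [hi]; exact mem_insert_self _ _⟩)
    refine ⟨G, c, hG, hcG, ⟨i, hi⟩, ?_⟩
    have hS : univ.image c ⊆ A.erase x := by
      intro v hv
      obtain ⟨i, -, rfl⟩ := mem_image.1 hv
      exact hc.2.1 i
    have hR : (A.erase x \ univ.image c).card = r := by
      rw [card_sdiff_of_subset hS, card_image_of_injective _ hc.1, card_univ, ZMod.card,
        card_erase_of_mem hxA, hcard]
      omega
    have hzS : z ∈ univ.image c := mem_image.2 ⟨i, mem_univ _, hi⟩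
    have hRT : r ≤ ((A.erase x \ univ.image c) \ T).card + (m - j - 1) := by
      have h1 : (A.erase x \ univ.image c) \ T = (A.erase x \ univ.image c) \ T0 := by
        ext v
        simp only [mem_sdiff, hTdef, mem_insert, not_or]
        constructor
        · tauto
        · rintro ⟨⟨h1, h2⟩, h3⟩
          refine ⟨⟨h1, h2⟩, ?_, h3⟩
          rintro rfl
          exact h2 hzS
      rw [h1]
      have := le_card_sdiff T0 (A.erase x \ univ.image c)
      omega
    have hloss : j - ((A.erase x \ univ.image c) \ T).card ≤ m - (r + 1) := by omega
    obtain ⟨e, rfl⟩ : ∃ e, m = r + 1 + e := ⟨m - (r + 1), by omega⟩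
    rw [Nat.add_sub_cancel_left] at hloss
    nlinarith

end LemB

section LemA
open Classical Finset

variable {U : Type*}

set_option maxHeartbeats 1000000 in
theorem lemA [Fintype U] (m s : ℕ) (hm : 2 ≤ m) (hs : s + 4 ≤ 2 * m) (hev : Even s) : ∀ r,
    ∀ (A : Finset U) (d : U → ℕ) (x : U), A.card = 2 * m + 1 + r → x ∈ A → (∀ v ∈ A, d x ≤ d v) →
    m + 1 ≤ d x → (∀ v ∈ A, d v ≤ 2 * m + r) →
    ∑ v ∈ A, d v = 3 * m ^ 2 + m + 2 * m * r + 2 + s → Alt m s A d x →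
    ∃ (G : SimpleGraph U) (c : ZMod (2 * m + 1) → U), Rz G A d ∧
      SCyc m G A c ∧ 2 * m ^ 2 + 2 * m + 2 ≤ E2 G (univ.image c) := by
  intro r
  induction r with
  | zero =>
    intro A d x hcard hxA hxmin hlow hup hsum halt
    have hne : (A.erase x).Nonempty := by rw [← card_pos, card_erase_of_mem hxA]; omega
    obtain ⟨z, hz, hzmax⟩ := exists_max_image _ d hne
    have hzA := mem_of_mem_erase hz
    have hzx := ne_of_mem_erase hz
    obtain ⟨G, c, h1, h2, -, h4⟩ := HB.base (m := m) (s := s) (A := A) (d := d) (z := z) (x := x)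
      ⟨hm, hcard, hzA, mem_erase.2 ⟨hzx.symm, hxA⟩, fun v hv => hxmin v (mem_of_mem_erase hv), hlow,
        hup, by
          intro v hv
          have := hxmin z hzA
          by_cases hvx : v = x
          · subst hvx; omega
          · have := hzmax v (mem_erase.2 ⟨hvx, mem_of_mem_erase hv⟩); omega, hsum, hs, hev, by
          rcases halt with h | h
          · exact Or.inl h
          · have := card_le_card (filter_subset_filter (fun v => d x + 2 ≤ d v) (erase_subset z A))
            right; omega⟩
    refine ⟨G, c, h1, h2, ?_⟩
    nlinarith
  | succ r ih =>
    intro A d x hcard hxA hxmin hlow hup hsum halt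
    by_cases hrm : r + 1 ≤ m
    · have hne : (A.erase x).Nonempty := by rw [← card_pos, card_erase_of_mem hxA]; omega
      obtain ⟨z, hz, hzmax⟩ := exists_max_image _ d hne
      have hzA := mem_of_mem_erase hz
      have hzx := ne_of_mem_erase hz
      obtain ⟨G, c, h1, h2, -, h4⟩ := lemB m s (r + 1) hrm A d z x
        ⟨hm, hcard, hzA, mem_erase.2 ⟨hzx.symm, hxA⟩, fun v hv => hxmin v (mem_of_mem_erase hv), hlow,
          hup, by
            intro v hv
            have := hxmin z hzA
            by_cases hvx : v = x
            · subst hvx; omega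
            · have := hzmax v (mem_erase.2 ⟨hvx, mem_of_mem_erase hv⟩); omega, hsum, hs, hev, by
            rcases halt with h | h
            · exact Or.inl h
            · have := card_le_card (filter_subset_filter (fun v => d x + 2 ≤ d v) (erase_subset z A))
              right; omega⟩
      refine ⟨G, c, h1, h2, ?_⟩
      obtain ⟨e, rfl⟩ : ∃ e, m = r + 1 + e := ⟨m - (r + 1), by omega⟩
      have : e ≤ e ^ 2 := Nat.le_self_pow (by norm_num) e
      nlinarith
    · have hn1 : d x + 1 ≤ 2 * m := by
        by_contra hcon
        have h1 := sum_lower (empty_subset A) d 0 (2 * m) (by simp) (fun w hw => by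
          have := hxmin w hw; omega)
        rw [card_empty, hcard, hsum] at h1
        simp only [zero_mul, Nat.sub_zero, zero_add] at h1
        nlinarith
      have hcardL : (A.erase x).card = 2 * m + 1 + r := by
        rw [card_erase_of_mem hxA, hcard]; omega
      obtain ⟨j, hj⟩ : ∃ j, d x = m + j := ⟨d x - m, by omega⟩
      obtain ⟨T, hT, hTc, htop⟩ := exists_top (A.erase x) d (m - j) (by omega)
      have hpos : ∀ t ∈ T, 1 ≤ d t := by
        intro t ht
        have := hxmin t (mem_of_mem_erase (hT ht)); omega
      set d' := lay d T with hd'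
      have hd : ∀ v, d v = d' v + if v ∈ T then 1 else 0 := lay_eq hpos
      have hsum' : ∑ v ∈ A.erase x, d' v + T.card = ∑ v ∈ A.erase x, d v := lay_sum hT hpos
      have hsum0 := hsum
      rw [← add_sum_erase A _ hxA] at hsum0
      have hne : (A.erase x).Nonempty := by rw [← card_pos]; omega
      obtain ⟨y, hy, hymin⟩ := exists_min_image _ d' hne
      have n4 : ∀ t ∈ T, m + 2 ≤ d t := by
        intro t ht
        by_contra hcon
        have hxt := hxmin t (mem_of_mem_erase (hT ht))
        have hj1 : j = 1 := by omega
        have h0 : 0 < T.card := card_pos.2 ⟨t, ht⟩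
        have hWc : (T.erase t).card = m - 2 := by rw [card_erase_of_mem ht]; omega
        have h1 := sum_upper (W := T.erase t) (L := A)
          (fun v hv => mem_of_mem_erase (hT (mem_of_mem_erase hv))) d (2 * m + (r + 1)) (m + 1)
          (fun w hw => hup w (mem_of_mem_erase (hT (mem_of_mem_erase hw))))
          (by
            intro w hw hwW
            by_cases hwx : w = x
            · subst hwx; omega
            by_cases hwt : w = t
            · subst hwt; omega
            have : w ∉ T := fun h' => hwW (mem_erase.2 ⟨hwt, h'⟩)
            have := htop t ht w (mem_sdiff.2 ⟨mem_erase.2 ⟨hwx, hw⟩, this⟩)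
            omega)
        rw [hWc, hcard, hsum] at h1
        obtain ⟨e, he⟩ : ∃ e, m = e + 2 := ⟨m - 2, by omega⟩
        have e1 : 2 * m + 1 + (r + 1) - (m - 2) = e + r + 6 := by omega
        have e2 : m - 2 = e := by omega
        rw [e1, e2] at h1
        subst he
        nlinarith
      have n3 : ∀ v ∈ A.erase x, v ∉ T → d v ≤ 2 * m + r := by
        intro v hv hvT
        by_contra hcon
        have hWc : (insert v T).card = m - j + 1 := by
          rw [card_insert_of_notMem hvT, hTc]
        have hWsub : insert v T ⊆ A := by
          intro w hw
          rcases mem_insert.1 hw with rfl | hw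
          · exact mem_of_mem_erase hv
          · exact mem_of_mem_erase (hT hw)
        have hWd : ∀ w ∈ insert v T, 2 * m + (r + 1) ≤ d w := by
          intro w hw
          rcases mem_insert.1 hw with rfl | hw
          · omega
          · have := htop w hw v (mem_sdiff.2 ⟨hv, hvT⟩); omega
        rcases halt with h1 | h1
        · have h2 := sum_lower hWsub d _ (d x) hWd hxmin
          rw [hWc, hcard, hj] at h2
          have e1 : 2 * m + 1 + (r + 1) - (m - j + 1) = m + j + (r + 1) := by omega
          rw [e1, add_mul (m - j)] at h2
          have h4 := num3 (m := m) (j := j) (r := r + 1) (s := s) (D := 2 * m + (r + 1)) (by omega)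
            (by refine le_trans (le_of_eq ?_) h2; ring) hsum
          have h6 := two_sq j
          omega
        · have : insert v T ⊆ A.filter fun v => d x + 2 ≤ d v := by
            intro w hw
            have := hWd w hw
            exact mem_filter.2 ⟨hWsub hw, by omega⟩
          have := card_le_card this
          omega
      obtain ⟨G', c, hG', hc, hE⟩ := ih (A.erase x) d' y hcardL hy hymin (by
          have h1 := hd y
          have h2 := hxmin y (mem_of_mem_erase hy)
          split_ifs at h1 with h3
          · have := n4 y h3; omega
          · omega) (by
          intro v hv
          have h1 := hd v
          split_ifs at h1 with h3
          · have := hup v (mem_of_mem_erase hv); omega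
          · have := n3 v hv h3; omega) (by
          have : 2 * m * (r + 1) = 2 * m * r + 2 * m := by ring
          omega) (alt_step hxmin hT htop (fun v _ => hd v) (by omega) (by omega) hy hymin halt)
      have hS : univ.image c ⊆ A.erase x := by
        intro v hv
        obtain ⟨i, -, rfl⟩ := mem_image.1 hv
        exact hc.2.1 i
      have hR : (A.erase x \ univ.image c).card = r := by
        rw [card_sdiff_of_subset hS, card_image_of_injective _ hc.1, card_univ, ZMod.card,
          card_erase_of_mem hxA, hcard]
        omega
      have hRT := le_card_sdiff T (A.erase x \ univ.image c)
      have hjR : j ≤ ((A.erase x \ univ.image c) \ T).card := by omega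
      obtain ⟨G, hG, hcG, hEG⟩ := step_lemma hxA hT hG' (fun v _ => hd v) j (by omega)
        (by omega) hc (fun q hq _ => hxmin q (mem_of_mem_erase hq)) (Or.inl hjR)
      refine ⟨G, c, hG, hcG, ?_⟩
      have : j - ((A.erase x \ univ.image c) \ T).card = 0 := by omega
      rw [this] at hEG
      omega

end LemA

section Phase1
open Classical Finset

variable {U : Type*}

theorem count_low {m r i : ℕ} {A : Finset U} {d : U → ℕ} {G : SimpleGraph U} (hi : 1 ≤ i) (him : i ≤ m)
    (hcard : A.card = 2 * m + 1 + r) (hG : Rz G A d)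
    (hF : (∀ v ∈ A, i + 1 ≤ d v) ∨ (2 * m + 1 - i) * (2 * m - i) + 2 * i * (r + i) + 2 ≤ ∑ v ∈ A, d v) :
    (A.filter fun v => d v ≤ i).card < r + i := by
  rcases hF with hF | hF
  · have : (A.filter fun v => d v ≤ i) = ∅ := by
      rw [filter_eq_empty_iff]
      intro v hv
      have := hF v hv
      omega
    rw [this, card_empty]; omega
  · by_contra hcon
    obtain ⟨B, hB, hBc⟩ := exists_subset_card_eq (not_lt.1 hcon)
    have hBA : B ⊆ A := hB.trans (filter_subset _ _)
    have h1 := count_bound G (sdiff_subset : A \ B ⊆ A) i (by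
      intro v hv
      rw [Finset.sdiff_sdiff_eq_self hBA] at hv
      rw [hG v (hBA hv)]
      exact (mem_filter.1 (hB hv)).2)
    have h2 : ∑ v ∈ A, dg G A v = ∑ v ∈ A, d v := sum_congr rfl hG
    rw [h2, card_sdiff_of_subset hBA, hcard, hBc] at h1
    have e1 : 2 * m + 1 + r - (r + i) = 2 * m + 1 - i := by omega
    have e2 : 2 * m + 1 - i - 1 = 2 * m - i := by omega
    have e3 : 2 * m + 1 + r - (2 * m + 1 - i) = r + i := by omega
    rw [e1, e2, e3] at h1
    omega

theorem even_base (m : ℕ) : Even (3 * m ^ 2 + m) := by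
  rcases Nat.even_or_odd m with hm | hm
  · exact ((hm.pow_of_ne_zero (by norm_num)).mul_left 3).add hm
  · exact ((by decide : Odd 3).mul hm.pow).add_odd hm

theorem Fm_eq (m r : ℕ) : (2 * m + 1 - m) * (2 * m - m) + 2 * m * (r + m) = 3 * m ^ 2 + m + 2 * m * r := by
  have e1 : 2 * m + 1 - m = m + 1 := by omega
  have e2 : 2 * m - m = m := by omega
  rw [e1, e2]; ring

set_option maxHeartbeats 1000000 in
theorem phase1 [Fintype U] (m : ℕ) (hm : 2 ≤ m) : ∀ r, ∀ (A : Finset U) (d : U → ℕ),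
    A.card = 2 * m + 1 + r → (∃ G : SimpleGraph U, Rz G A d) →
    3 * m ^ 2 + m + 2 * m * r + 2 ≤ ∑ v ∈ A, d v →
    (∀ i, 1 ≤ i → i < m → (∀ v ∈ A, i + 1 ≤ d v) ∨
      (2 * m + 1 - i) * (2 * m - i) + 2 * i * (r + i) + 2 ≤ ∑ v ∈ A, d v) →
    ∃ G : SimpleGraph U, Rz G A d ∧ ∀ l, 3 ≤ l → l ≤ 2 * m + 1 → CycIn G A l := by
  intro r
  induction r with
  | zero =>
    rintro A d hcard ⟨G, hG⟩ hσ hF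
    refine ⟨G, hG, ?_⟩
    obtain ⟨c, hc⟩ := posa (m := m) (by omega) (A := A) (by omega) G (by
      intro i hi him
      have h1 : (A.filter fun v => dg G A v ≤ i) = A.filter fun v => d v ≤ i :=
        filter_congr fun v hv => by rw [hG v hv]
      rw [h1]
      have := count_low (r := 0) hi him hcard hG (by
        by_cases h : i = m
        · subst h
          right
          rw [Fm_eq]; exact hσ
        · exact hF i hi (by omega))
      omega)
    have hsub : univ.image c ⊆ A := by
      intro v hv
      obtain ⟨i, -, rfl⟩ := mem_image.1 hv
      exact hc.2.1 i
    have himg : univ.image c = A := by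
      apply eq_of_subset_of_card_le hsub
      rw [card_image_of_injective _ hc.1, card_univ, ZMod.card, hcard]
    apply bondy (by omega) hc
    rw [himg]
    unfold E2
    rw [sum_congr rfl hG]
    nlinarith
  | succ r ih =>
    rintro A d hcard hex hσ hF
    have hne : A.Nonempty := by rw [← card_pos]; omega
    obtain ⟨x, hxA, hxmin⟩ := exists_min_image A d hne
    have hcardL : (A.erase x).card = 2 * m + 1 + r := by
      rw [card_erase_of_mem hxA, hcard]; omega
    have hsum0 := add_sum_erase A d hxA
    obtain ⟨G0, hG0⟩ := hex
    have hup : ∀ v ∈ A, d v ≤ 2 * m + (r + 1) := by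
      intro v hv
      have := dg_lt G0 hv
      rw [hG0 v hv] at this
      omega
    have e2mr : 2 * m * (r + 1) = 2 * m * r + 2 * m := by ring
    by_cases hcase : 3 * m ^ 2 + m + 2 * m * (r + 1) + 2 + 2 * d x ≤ ∑ v ∈ A, d v + 2 * m
    · obtain ⟨T, hT, hTc, htop⟩ := exists_top (A.erase x) d (d x) (by
        have := hup x hxA; omega)
      obtain ⟨G, hG, hGx⟩ := hh hxA hT hTc htop ⟨G0, hG0⟩
      have hpos : ∀ t ∈ T, 1 ≤ d t := by
        intro t ht
        have htA := mem_of_mem_erase (hT ht)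
        have h1 := dg_erase G hxA t
        rw [if_pos ((hGx t htA).2 ht).symm, hG t htA] at h1
        omega
      set d' := lay d T with hd'
      have hd : ∀ v, d v = d' v + if v ∈ T then 1 else 0 := lay_eq hpos
      have hsum' : ∑ v ∈ A.erase x, d' v + T.card = ∑ v ∈ A.erase x, d v := lay_sum hT hpos
      have hreal : Rz G (A.erase x) d' := by
        intro v hv
        have hvA := mem_of_mem_erase hv
        have h1 := dg_erase G hxA v
        have h2 := hd v
        rw [hG v hvA] at h1
        have h3 : G.Adj v x ↔ v ∈ T := by rw [G.adj_comm]; exact hGx v hvA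
        simp only [h3] at h1
        omega
      obtain ⟨G', hG', hcyc⟩ := ih (A.erase x) d' hcardL ⟨G, hreal⟩ (by omega) (by
        intro i hi him
        by_cases hix : d x ≤ i
        · right
          rcases hF i hi him with h | h
          · have := h x hxA; omega
          · have : 2 * i * (r + 1 + i) = 2 * i * (r + i) + 2 * i := by ring
            omega
        · left
          intro v hv
          have h1 := hd v
          have h2 := hxmin v (mem_of_mem_erase hv)
          split_ifs at h1 with hvT
          · by_cases hix2 : i + 2 ≤ d x
            · omega
            · have hcl := count_low (r := r + 1) (i := m) (by omega) le_rfl hcard hG0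
                (Or.inr (by rw [Fm_eq]; exact hσ))
              have : m + 1 ≤ d v := by
                by_contra hcon
                have hsub : A \ (A.filter fun v => d v ≤ m) ⊆ T.erase v := by
                  intro w hw
                  rw [mem_sdiff, mem_filter] at hw
                  have hwm : m < d w := by
                    by_contra h'
                    exact hw.2 ⟨hw.1, by omega⟩
                  refine mem_erase.2 ⟨?_, ?_⟩
                  · rintro rfl; omega
                  · by_contra hwT
                    have hwx : w ≠ x := by rintro rfl; omega
                    have := htop v hvT w (mem_sdiff.2 ⟨mem_erase.2 ⟨hwx, hw.1⟩, hwT⟩)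
                    omega
                have := card_le_card hsub
                rw [card_sdiff_of_subset (filter_subset _ _), card_erase_of_mem hvT] at this
                omega
              omega
          · omega)
      refine ⟨addV G' x T, rz_addV hxA hT hG' (fun v _ => hd v) hTc.symm, ?_⟩
      intro l hl1 hl2
      exact (hcyc l hl1 hl2).mono (by omega) (erase_subset _ _) fun u hu v hv huv =>
        Or.inl ⟨huv, ne_of_mem_erase hu, ne_of_mem_erase hv⟩
    · obtain ⟨s, hs⟩ : ∃ s, ∑ v ∈ A, d v = 3 * m ^ 2 + m + 2 * m * (r + 1) + 2 + s :=
        ⟨_, (Nat.add_sub_of_le hσ).symm⟩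
      have hev : Even s := by
        have h1 := sum_dg_even G0 A
        rw [sum_congr rfl hG0, hs] at h1
        have h2 : Even (3 * m ^ 2 + m + 2 * m * (r + 1) + 2) :=
          ((even_base m).add (by rw [mul_assoc]; exact even_two_mul _)).add even_two
        exact (Nat.even_add.1 h1).1 h2
      have hsd : s + 2 + 2 * m ≤ 2 * d x := by
        obtain ⟨t, ht⟩ := hev
        omega
      have hn1 : d x + 1 ≤ 2 * m := by
        by_contra hcon
        have h1 := sum_lower (empty_subset A) d 0 (d x) (by simp) hxmin
        rw [card_empty, hcard, hs] at h1
        simp only [zero_mul, Nat.sub_zero, zero_add] at h1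
        obtain ⟨e, he⟩ : ∃ e, d x = 2 * m + e := ⟨d x - 2 * m, by omega⟩
        rw [he] at h1 hsd
        nlinarith
      obtain ⟨G, c, hG, hc, hE⟩ := lemA m s hm (by omega) hev (r + 1) A d x hcard hxA hxmin (by omega)
        hup hs (Or.inl hsd)
      exact ⟨G, hG, bondy (by omega) hc hE⟩

end Phase1

section Final
open Classical Finset

theorem dg_univ_eq {n : ℕ} (G : SimpleGraph (Fin n)) (i : Fin n) :
    (G.neighborSet i).ncard = dg G univ i := by
  unfold dg
  rw [← Set.ncard_coe_finset]
  congr 1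
  ext v
  simp

theorem F_bound {m r i σ : ℕ} (hi : 1 ≤ i) (him : i ≤ m)
    (h1 : 4 * m ^ 2 + 2 + 2 * r + 2 ≤ σ + 2 * m) (hm : 3 * m ^ 2 + m + 2 * m * r + 2 ≤ σ) :
    (2 * m + 1 - i) * (2 * m - i) + 2 * i * (r + i) + 2 ≤ σ := by
  obtain ⟨b, rfl⟩ : ∃ b, m = i + b := ⟨m - i, by omega⟩
  obtain ⟨a, rfl⟩ : ∃ a, i = 1 + a := ⟨i - 1, by omega⟩
  have e1 : 2 * (1 + a + b) + 1 - (1 + a) = 2 + a + 2 * b := by omega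
  have e2 : 2 * (1 + a + b) - (1 + a) = 1 + a + 2 * b := by omega
  rw [e1, e2]
  rcases le_total (3 * (a + 2) + 2 * r) (4 * (1 + a + b) + 1) with h | h
  · have := Nat.mul_le_mul_left a h
    nlinarith
  · have := Nat.mul_le_mul_left b h
    nlinarith [Nat.zero_le (b * b)]

end Final

/-- **Upper bound argument for `σ(C_{2m+1}, n)`.** Let `m ≥ 2`, `n ≥ 2m+1` and let
`π = (d₁,…,dₙ)` be a non-increasing graphic sequence with
`σ(π) ≥ max{2n + 4m² - 6m, m(2n - m - 1)} + 2`. Then `π` is potentially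
`C_{2m+1}`-graphic; moreover `d_{2m+2-i} ≥ i+1` for every `1 ≤ i ≤ m`, so `π` even has a
realization containing cycles of every length from `3` to `2m+1`. -/
theorem sigma_C_odd_upper (m n : ℕ) (hm : 2 ≤ m) (hn : 2 * m + 1 ≤ n) (d : Fin n → ℕ)
    (hanti : Antitone d) (hgr : Graphic d)
    (hσ : max (2 * n + 4 * m ^ 2 - 6 * m) (m * (2 * n - m - 1)) + 2 ≤ ∑ i, d i) :
    PotC (2 * m + 1) d ∧
    (∀ i : ℕ, ∀ _ : 1 ≤ i, ∀ _ : i ≤ m, i + 1 ≤ d ⟨2 * m + 1 - i, by omega⟩) ∧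
    Pot3C (2 * m + 1) d := by
  obtain ⟨r, rfl⟩ : ∃ r, n = 2 * m + 1 + r := ⟨n - (2 * m + 1), by omega⟩
  have hA : (Finset.univ : Finset (Fin (2 * m + 1 + r))).card = 2 * m + 1 + r := by simp
  obtain ⟨G0, hG0⟩ := hgr
  have hR0 : Rz G0 Finset.univ d := fun v _ => by rw [← dg_univ_eq]; exact hG0 v
  have h1 := (add_le_add_left (le_max_left _ _) 2).trans hσ
  have h2 := (add_le_add_left (le_max_right _ _) 2).trans hσ
  have hF1 : 4 * m ^ 2 + 2 + 2 * r + 2 ≤ ∑ i, d i + 2 * m := by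
    omega
  have hFm : 3 * m ^ 2 + m + 2 * m * r + 2 ≤ ∑ i, d i := by
    have e : 2 * (2 * m + 1 + r) - m - 1 = 3 * m + 1 + 2 * r := by omega
    rw [e] at h2
    nlinarith
  have hF : ∀ i, 1 ≤ i → i ≤ m →
      (2 * m + 1 - i) * (2 * m - i) + 2 * i * (r + i) + 2 ≤ ∑ v, d v :=
    fun i hi him => F_bound hi him hF1 hFm
  obtain ⟨G, hG, hcyc⟩ := phase1 m hm r Finset.univ d hA ⟨G0, hR0⟩ hFm
    (fun i hi him => Or.inr (hF i hi him.le))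
  have hdeg : IsDegreeSeq G d := fun i => by rw [dg_univ_eq]; exact hG i (Finset.mem_univ i)
  refine ⟨⟨G, hdeg, (hcyc _ (by omega) le_rfl).walk (by omega)⟩, ?_,
    ⟨G, hdeg, fun l hl hl2 => (hcyc l hl hl2).walk hl⟩⟩
  intro i hi him
  by_contra hcon
  have hcl := count_low hi him hA hR0 (Or.inr (hF i hi him))
  have hsub : Finset.Ici (⟨2 * m + 1 - i, by omega⟩ : Fin (2 * m + 1 + r)) ⊆
      Finset.univ.filter fun v => d v ≤ i := by
    intro v hv
    have := hanti (Finset.mem_Ici.1 hv)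
    exact Finset.mem_filter.2 ⟨Finset.mem_univ _, by omega⟩
  have h3 := Finset.card_le_card hsub
  rw [Fin.card_Ici] at h3
  have h4 : (Finset.univ.filter fun v => d v ≤ i).card < r + i := by convert hcl
  simp only at h3
  omega
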